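/- Let g be a psd sextic form in ℝ[x₀,x₁,x₂] that is not a sum of squares. Call g exposed if every psd sextic form g' with V_ℝ(g) ⊆ V_ℝ(g') is a nonnegative scalar multiple of g. Then g is exposed if and only if its real projective zero set V_ℝ(g) has exactly 10 points. -/

import Mathlib

open MvPolynomial

noncomputable section

/-- The real projective plane, as lines through the origin of `ℝ³`. -/
abbrev P2 := Projectivization ℝ (Fin 3 → ℝ)

/-- A polynomial is psd if it takes only nonnegative values on `ℝ³`. -/
def Psd (g : MvPolynomial (Fin 3) ℝ) : Prop := ∀ u : Fin 3 → ℝ, 0 ≤ eval u g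

/-- A polynomial is sos if it is a finite sum of squares. -/
def Sos (g : MvPolynomial (Fin 3) ℝ) : Prop :=
  ∃ (n : ℕ) (h : Fin n → MvPolynomial (Fin 3) ℝ), g = ∑ i, (h i) ^ 2

/-- A form vanishes at a point of `ℙ²(ℝ)` if it vanishes at a representative vector. -/
def VanishAt (g : MvPolynomial (Fin 3) ℝ) (P : P2) : Prop := eval P.rep g = 0

/-- A form is singular at a point of `ℙ²(ℝ)` if it and all its first partial
derivatives vanish at a representative vector. -/
def SingAt (g : MvPolynomial (Fin 3) ℝ) (P : P2) : Prop :=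
  eval P.rep g = 0 ∧ ∀ i, eval P.rep (pderiv i g) = 0

/-- `I_d(T)`: the space of degree-`d` forms vanishing at every point of `T`. -/
def Isub (d : ℕ) (T : Set P2) : Submodule ℝ (MvPolynomial (Fin 3) ℝ) :=
  (homogeneousSubmodule (Fin 3) ℝ d) ⊓
  { carrier := {f | ∀ P ∈ T, VanishAt f P}
    zero_mem' := by intro P _; simp [VanishAt]
    add_mem' := by
      intro a b ha hb P hP
      have h1 := ha P hP; have h2 := hb P hP
      unfold VanishAt at *; simp [h1, h2]
    smul_mem' := by
      intro c f hf P hP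
      have h1 := hf P hP
      unfold VanishAt at *; simp [smul_eq_C_mul, h1] }

/-- `I_d(2T)`: the space of degree-`d` forms singular at every point of `T`. -/
def Isub2 (d : ℕ) (T : Set P2) : Submodule ℝ (MvPolynomial (Fin 3) ℝ) :=
  (homogeneousSubmodule (Fin 3) ℝ d) ⊓
  { carrier := {f | ∀ P ∈ T, SingAt f P}
    zero_mem' := by intro P _; constructor <;> simp [SingAt]
    add_mem' := by
      intro a b ha hb P hP
      obtain ⟨h1, h2⟩ := ha P hP; obtain ⟨h3, h4⟩ := hb P hP
      exact ⟨by simp [h1, h3], fun i => by simp [h2 i, h4 i]⟩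
    smul_mem' := by
      intro c f hf P hP
      obtain ⟨h1, h2⟩ := hf P hP
      refine ⟨by simp [smul_eq_C_mul, h1], fun i => ?_⟩
      have := h2 i
      simp [smul_eq_C_mul, this] }

/-- `I₃(T)²`: the span of products of two cubics vanishing on `T`. -/
def IsqCubic (T : Set P2) : Submodule ℝ (MvPolynomial (Fin 3) ℝ) :=
  Submodule.span ℝ {h | ∃ f₁ ∈ Isub 3 T, ∃ f₂ ∈ Isub 3 T, h = f₁ * f₂}

/-- No 4 points of `T` on a line, no 7 on a conic. -/
def GenPos (T : Set P2) : Prop :=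
  (∀ l : MvPolynomial (Fin 3) ℝ, l ≠ 0 → l.IsHomogeneous 1 →
    {P ∈ T | VanishAt l P}.encard ≤ 3) ∧
  (∀ c : MvPolynomial (Fin 3) ℝ, c ≠ 0 → c.IsHomogeneous 2 →
    {P ∈ T | VanishAt c P}.encard ≤ 6)

/-- The real projective zero set of `g`. -/
def VR (g : MvPolynomial (Fin 3) ℝ) : Set P2 := {P | VanishAt g P}


noncomputable section
set_option linter.unusedSectionVars false
set_option linter.unusedSimpArgs false
/-! ### Homogeneous factors -/

section Hom
variable {K : Type*} [Field K]

/-- The homomorphism `F ↦ F(T x)`. -/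
def scaleHom (K : Type*) [Field K] : MvPolynomial (Fin 3) K →ₐ[K] Polynomial (MvPolynomial (Fin 3) K) :=
  aeval (fun i => Polynomial.C (X i) * Polynomial.X)

lemma scaleHom_of_hom {n : ℕ} {F : MvPolynomial (Fin 3) K} (hF : F.IsHomogeneous n) :
    scaleHom K F = Polynomial.C F * Polynomial.X ^ n := by
  classical
  have key : ∀ (d : Fin 3 →₀ ℕ) (r : K), scaleHom K (monomial d r)
      = Polynomial.C (monomial d r) * Polynomial.X ^ d.degree := by
    intro d r
    rw [scaleHom, aeval_monomial, monomial_eq, Finsupp.prod, Finsupp.prod, Finsupp.degree]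
    simp only [mul_pow, Finset.prod_mul_distrib, Finset.prod_pow_eq_pow_sum, map_mul, map_prod, map_pow]
    rw [← mul_assoc]
    rfl
  conv_lhs => rw [F.as_sum]
  conv_rhs => rw [F.as_sum]
  rw [map_sum, map_sum, Finset.sum_mul]
  refine Finset.sum_congr rfl fun d hd => ?_
  rw [key, hF.degree_eq_sum_deg_support hd]
  rfl

lemma scaleHom_coeff (F : MvPolynomial (Fin 3) K) (n : ℕ) :
    (scaleHom K F).coeff n = homogeneousComponent n F := by
  conv_lhs => rw [← sum_homogeneousComponent F]
  rw [map_sum, Polynomial.finsetSum_coeff]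
  simp_rw [scaleHom_of_hom (homogeneousComponent_isHomogeneous _ F), Polynomial.coeff_C_mul_X_pow]
  rw [Finset.sum_ite_eq]
  split_ifs with h
  · rfl
  · symm; apply homogeneousComponent_eq_zero
    simp at h; omega

lemma hom_of_mul_left {n : ℕ} {p q : MvPolynomial (Fin 3) K} (h : (p * q).IsHomogeneous n)
    (h0 : p * q ≠ 0) : ∃ a b, a + b = n ∧ p.IsHomogeneous a ∧ q.IsHomogeneous b := by
  have hp : p ≠ 0 := left_ne_zero_of_mul h0
  have hq : q ≠ 0 := right_ne_zero_of_mul h0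
  have inj : ∀ F : MvPolynomial (Fin 3) K, F ≠ 0 → scaleHom K F ≠ 0 := by
    intro F hF hz
    apply hF
    rw [← sum_homogeneousComponent F]
    refine Finset.sum_eq_zero fun i _ => ?_
    rw [← scaleHom_coeff, hz]; simp
  have e := scaleHom_of_hom h
  rw [map_mul] at e
  have hP := inj p hp
  have hQ := inj q hq
  have e1 := congrArg Polynomial.natDegree e
  have e2 := congrArg Polynomial.natTrailingDegree e
  rw [Polynomial.natDegree_mul hP hQ, Polynomial.natDegree_C_mul_X_pow _ _ h0] at e1
  rw [Polynomial.natTrailingDegree_mul hP hQ, Polynomial.C_mul_X_pow_eq_monomial,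
    Polynomial.natTrailingDegree_monomial h0] at e2
  have l1 := Polynomial.natTrailingDegree_le_natDegree (scaleHom K p)
  have l2 := Polynomial.natTrailingDegree_le_natDegree (scaleHom K q)
  have fin : ∀ F : MvPolynomial (Fin 3) K,
      (scaleHom K F).natTrailingDegree = (scaleHom K F).natDegree →
      F.IsHomogeneous (scaleHom K F).natDegree := by
    intro F hF
    have : F = homogeneousComponent (scaleHom K F).natDegree F := by
      conv_lhs => rw [← sum_homogeneousComponent F]
      by_cases hm : (scaleHom K F).natDegree ∈ Finset.range (F.totalDegree + 1)
      · refine Finset.sum_eq_single_of_mem _ hm fun i _ hi => ?_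
        rw [← scaleHom_coeff]
        rcases lt_or_gt_of_ne hi with h | h
        · exact Polynomial.coeff_eq_zero_of_lt_natTrailingDegree (by omega)
        · exact Polynomial.coeff_eq_zero_of_natDegree_lt h
      · rw [homogeneousComponent_eq_zero]
        · refine Finset.sum_eq_zero fun i hi => ?_
          simp at hm hi
          rw [← scaleHom_coeff]
          exact Polynomial.coeff_eq_zero_of_lt_natTrailingDegree (by omega)
        · simp at hm; omega
    conv_lhs => rw [this]
    exact homogeneousComponent_isHomogeneous _ _
  exact ⟨_, _, e1, fin p (by omega), fin q (by omega)⟩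

lemma finrank_hom (d : ℕ) : Module.finrank K (homogeneousSubmodule (Fin 3) K d) = (d + 2).choose 2 := by
  classical
  rw [homogeneousSubmodule_eq_finsupp_supported]
  have e := (AddMonoidAlgebra.supportedEquivFinsupp (S := K) (R := K) {d' : Fin 3 →₀ ℕ | d'.degree = d})
  rw [LinearEquiv.finrank_eq e]
  have hs : {d' : Fin 3 →₀ ℕ | d'.degree = d} = ((Finset.univ.finsuppAntidiag d : Finset (Fin 3 →₀ ℕ)) : Set _) := by
    ext x
    simp [Finset.mem_finsuppAntidiag, Finsupp.degree_eq_sum]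
  rw [hs]
  rw [Module.finrank_finsupp_self]
  have := Finset.card_finsuppAntidiag_nat_eq_choose (s := (Finset.univ : Finset (Fin 3))) d
  simp [this]
  rw [add_comm 2 d]; exact Nat.choose_symm_add

instance fin_hom (d : ℕ) : Module.Finite K (homogeneousSubmodule (Fin 3) K d) := by
  rw [Module.finite_def, Submodule.fg_top]
  exact homogeneousSubmodule_fg _ _ d

/-- There is a form through few points. -/
lemma exists_form {N d : ℕ} (v : Fin N → Fin 3 → K) (h : N < (d + 2).choose 2) :
    ∃ F : MvPolynomial (Fin 3) K, F.IsHomogeneous d ∧ F ≠ 0 ∧ ∀ i, eval (v i) F = 0 := by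
  let φ : homogeneousSubmodule (Fin 3) K d →ₗ[K] (Fin N → K) :=
    LinearMap.pi fun i => ((aeval (v i) : MvPolynomial (Fin 3) K →ₐ[K] K).toLinearMap).comp
      (Submodule.subtype _)
  have : LinearMap.ker φ ≠ ⊥ := by
    apply LinearMap.ker_ne_bot_of_finrank_lt
    rw [finrank_hom]; simpa
  obtain ⟨x, hx, hx0⟩ := (Submodule.ne_bot_iff _).1 this
  refine ⟨x.1, x.2, by simpa using hx0, fun i => ?_⟩
  have := congrFun (LinearMap.mem_ker.1 hx) i
  simpa [φ, coe_aeval_eq_eval] using this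

end Hom
end

noncomputable section
set_option linter.unusedSectionVars false
set_option linter.unusedSimpArgs false
/-! ### Second order functionals at points -/
section Fun
variable {K : Type*} [Field K]

/-- Linear form with coefficient vector `a`. -/
def lin (a : Fin 3 → K) : MvPolynomial (Fin 3) K := C (a 0) * X 0 + C (a 1) * X 1 + C (a 2) * X 2

lemma lin_hom (a : Fin 3 → K) : (lin a).IsHomogeneous 1 :=
  ((isHomogeneous_C_mul_X _ _).add (isHomogeneous_C_mul_X _ _)).add (isHomogeneous_C_mul_X _ _)

lemma eval_lin (a v : Fin 3 → K) : eval v (lin a) = a 0 * v 0 + a 1 * v 1 + a 2 * v 2 := by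
  simp [lin]

lemma pderiv_lin (a : Fin 3 → K) (i : Fin 3) : pderiv i (lin a) = C (a i) := by
  fin_cases i <;> simp [lin, pderiv_X, Pi.single_apply]

/-- The second order functional at `v` with coefficients `c`. -/
def LL (v : Fin 3 → K) : (Fin 6 → K) →ₗ[K] MvPolynomial (Fin 3) K →ₗ[K] K :=
  LinearMap.mk₂ K (fun c F => c 0 * eval v (pderiv 0 (pderiv 0 F)) + c 1 * eval v (pderiv 0 (pderiv 1 F))
    + c 2 * eval v (pderiv 0 (pderiv 2 F)) + c 3 * eval v (pderiv 1 (pderiv 1 F))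
    + c 4 * eval v (pderiv 1 (pderiv 2 F)) + c 5 * eval v (pderiv 2 (pderiv 2 F)))
    (by intros; simp only [Pi.add_apply]; ring)
    (by intros; simp only [Pi.smul_apply, smul_eq_mul]; ring)
    (by intros; simp only [map_add]; ring)
    (by intros; simp only [Derivation.map_smul, smul_eval, smul_eq_mul]; ring)

lemma LL_apply (v : Fin 3 → K) (c : Fin 6 → K) (F : MvPolynomial (Fin 3) K) :
    LL v c F = c 0 * eval v (pderiv 0 (pderiv 0 F)) + c 1 * eval v (pderiv 0 (pderiv 1 F))
    + c 2 * eval v (pderiv 0 (pderiv 2 F)) + c 3 * eval v (pderiv 1 (pderiv 1 F))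
    + c 4 * eval v (pderiv 1 (pderiv 2 F)) + c 5 * eval v (pderiv 2 (pderiv 2 F)) := rfl

/-- Bilinear form associated to `c`. -/
def bil (c : Fin 6 → K) (x y : Fin 3 → K) : K :=
  2 * c 0 * x 0 * y 0 + c 1 * (x 0 * y 1 + x 1 * y 0) + c 2 * (x 0 * y 2 + x 2 * y 0)
  + 2 * c 3 * x 1 * y 1 + c 4 * (x 1 * y 2 + x 2 * y 1) + 2 * c 5 * x 2 * y 2

/-- Singular at a vector. -/
def Sg (F : MvPolynomial (Fin 3) K) (v : Fin 3 → K) : Prop :=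
  eval v F = 0 ∧ ∀ i, eval v (pderiv i F) = 0

lemma LL_mul_sing {F : MvPolynomial (Fin 3) K} {v : Fin 3 → K} (h : Sg F v) (c : Fin 6 → K)
    (A : MvPolynomial (Fin 3) K) : LL v c (F * A) = eval v A * LL v c F := by
  obtain ⟨h0, h1⟩ := h
  simp only [LL_apply, pderiv_mul, map_add, map_mul, h0, h1]
  ring

lemma LL_lin_mul {a v : Fin 3 → K} (h : eval v (lin a) = 0) (c : Fin 6 → K)
    (A : MvPolynomial (Fin 3) K) :
    LL v c (lin a * A) = bil c a (fun i => eval v (pderiv i A)) := by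
  simp only [LL_apply, pderiv_mul, map_add, map_mul, h, pderiv_lin, pderiv_C, eval_C, bil, map_zero]
  ring

lemma sg_mul {F G : MvPolynomial (Fin 3) K} {v : Fin 3 → K} (h : eval v F = 0) (h' : eval v G = 0) :
    Sg (F * G) v := by
  refine ⟨by simp [h], fun i => ?_⟩
  simp [pderiv_mul, h, h']

lemma euler1 {n : ℕ} {F : MvPolynomial (Fin 3) K} (hF : F.IsHomogeneous n) (v : Fin 3 → K) :
    v 0 * eval v (pderiv 0 F) + v 1 * eval v (pderiv 1 F) + v 2 * eval v (pderiv 2 F)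
      = n * eval v F := by
  have := congrArg (eval v) hF.sum_X_mul_pderiv
  simpa [Fin.sum_univ_three] using this

lemma pderiv_comm3 (i j : Fin 3) (F : MvPolynomial (Fin 3) K) :
    pderiv i (pderiv j F) = pderiv j (pderiv i F) := by
  have : ⁅(pderiv i : Derivation K (MvPolynomial (Fin 3) K) (MvPolynomial (Fin 3) K)), pderiv j⁆ = (0 : Derivation K (MvPolynomial (Fin 3) K) (MvPolynomial (Fin 3) K)) := by
    apply derivation_ext
    intro k
    rw [Derivation.commutator_apply]
    simp only [pderiv_X, Pi.single_apply]
    split_ifs <;> simp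
  have h2 := congrArg (fun D => D F) this
  simp only [Derivation.commutator_apply, Derivation.coe_zero, Pi.zero_apply] at h2
  exact sub_eq_zero.1 h2

/-- first-order functionals: direction `w` -/
def dirc (v : Fin 3 → K) : (Fin 3 → K) →ₗ[K] (Fin 6 → K) :=
  LinearMap.pi ![v 0 • LinearMap.proj 0, v 0 • LinearMap.proj 1 + v 1 • LinearMap.proj 0,
    v 0 • LinearMap.proj 2 + v 2 • LinearMap.proj 0, v 1 • LinearMap.proj 1,
    v 1 • LinearMap.proj 2 + v 2 • LinearMap.proj 1, v 2 • LinearMap.proj 2]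

lemma LL_dirc {n : ℕ} {F : MvPolynomial (Fin 3) K} (hF : F.IsHomogeneous (n + 1)) (v w : Fin 3 → K) :
    LL v (dirc v w) F = n * (w 0 * eval v (pderiv 0 F) + w 1 * eval v (pderiv 1 F)
      + w 2 * eval v (pderiv 2 F)) := by
  have e := fun i => euler1 (n := n) (hF.pderiv (i := i)) v
  have e0 := e 0
  have e1 := e 1
  have e2 := e 2
  rw [LL_apply]
  simp [dirc]
  rw [pderiv_comm3 1 0] at e0
  rw [pderiv_comm3 2 0] at e0
  rw [pderiv_comm3 2 1] at e1
  linear_combination w 0 * e0 + w 1 * e1 + w 2 * e2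

lemma dirc_inj {v : Fin 3 → K} (hv : v ≠ 0) [CharZero K] : Function.Injective (dirc v) := by
  rw [← LinearMap.ker_eq_bot, LinearMap.ker_eq_bot']
  intro w hw
  have h := fun i => congrFun hw i
  have h0 := h 0
  have h1 := h 1
  have h2 := h 2
  have h3 := h 3
  have h4 := h 4
  have h5 := h 5
  simp [dirc] at h0 h1 h2 h3 h4 h5
  ext i
  by_cases a0 : v 0 = 0
  · by_cases a1 : v 1 = 0
    · have a2 : v 2 ≠ 0 := fun a2 => hv (by ext i; fin_cases i <;> simp [a0, a1, a2])
      fin_cases i <;> simp_all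
    · fin_cases i <;> simp_all
  · fin_cases i <;> simp_all

lemma euler2 {n : ℕ} {F : MvPolynomial (Fin 3) K} (hF : F.IsHomogeneous (n + 1)) (v : Fin 3 → K) :
    LL v (dirc v v) F = n * ((n + 1) * eval v F) := by
  rw [LL_dirc hF, euler1 hF]; push_cast; ring

end Fun
end

noncomputable section
set_option linter.unusedSectionVars false
set_option linter.unusedSimpArgs false
section Bez
variable {K : Type*} [Field K] [CharZero K]

lemma exists_lin_ne {v : Fin 3 → K} (hv : v ≠ 0) : ∃ n : Fin 3 → K, eval v (lin n) ≠ 0 := by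
  obtain ⟨i, hi⟩ := Function.ne_iff.1 hv
  refine ⟨Pi.single i 1, ?_⟩
  rw [eval_lin]
  fin_cases i <;> simpa using hi

lemma indep_one {v : Fin 3 → K} (hv : v ≠ 0) {s e : ℕ} {G : MvPolynomial (Fin 3) K}
    (hG : G.IsHomogeneous s) (hGv : eval v G ≠ 0) (c : Fin 6 → K)
    (h : ∀ A : MvPolynomial (Fin 3) K, A.IsHomogeneous (e + 3) → LL v c (G * A) = 0) : c = 0 := by
  obtain ⟨n, hn⟩ := exists_lin_ne hv
  have s1 : ∀ a b : Fin 3 → K, eval v (lin a) = 0 → eval v (lin b) = 0 → bil c a b = 0 := by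
    intro a b ha hb
    have h1 := h (lin a * lin b * lin n ^ (e + 1)) (by
      have := ((lin_hom a).mul (lin_hom b)).mul ((lin_hom n).pow (e + 1))
      convert this using 1; ring)
    have e1 : G * (lin a * lin b * lin n ^ (e + 1)) = (lin a * lin b) * (G * lin n ^ (e + 1)) := by ring
    rw [e1, LL_mul_sing (sg_mul ha hb), LL_lin_mul ha] at h1
    have h2 := (mul_eq_zero.1 h1).resolve_left (by
      rw [map_mul, map_pow]; exact mul_ne_zero hGv (pow_ne_zero _ hn))
    simpa [pderiv_lin] using h2
  obtain ⟨w, hwdef⟩ : ∃ w : Fin 3 → K, w = fun i => eval v (pderiv i (G * lin n ^ (e + 2))) := ⟨_, rfl⟩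
  have s2 : ∀ a : Fin 3 → K, eval v (lin a) = 0 → bil c a w = 0 := by
    intro a ha
    have h1 := h (lin a * lin n ^ (e + 2)) (by
      have := (lin_hom a).mul ((lin_hom n).pow (e + 2))
      convert this using 1; ring)
    have e1 : G * (lin a * lin n ^ (e + 2)) = lin a * (G * lin n ^ (e + 2)) := by ring
    rw [e1, LL_lin_mul ha] at h1
    rw [hwdef]; exact h1
  have hw : eval v (lin w) ≠ 0 := by
    have := euler1 (hG.mul ((lin_hom n).pow (e + 2))) v
    rw [eval_lin, hwdef]
    simp only
    rw [mul_comm _ (v 0), mul_comm _ (v 1), mul_comm _ (v 2), this]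
    rw [map_mul, map_pow]
    refine mul_ne_zero ?_ (mul_ne_zero hGv (pow_ne_zero _ hn))
    exact_mod_cast (by omega : s + 1 * (e + 2) ≠ 0)
  have s3 : ∀ a y : Fin 3 → K, eval v (lin a) = 0 → bil c a y = 0 := by
    intro a y ha
    obtain ⟨t, ht⟩ : ∃ t, t * eval v (lin w) = eval v (lin y) := ⟨_, div_mul_cancel₀ _ hw⟩
    have h1 := s1 a (y - t • w) ha (by
      simp only [eval_lin, Pi.sub_apply, Pi.smul_apply, smul_eq_mul] at ht ⊢
      linear_combination -ht)
    have h2 := s2 a ha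
    simp only [bil, Pi.sub_apply, Pi.smul_apply, smul_eq_mul] at h1 h2 ⊢
    linear_combination h1 + t * h2
  have s4 : ∀ x y : Fin 3 → K, eval v (lin n) * bil c x y = eval v (lin x) * bil c n y := by
    intro x y
    have := s3 (eval v (lin n) • x - eval v (lin x) • n) y (by
      simp only [eval_lin, Pi.sub_apply, Pi.smul_apply, smul_eq_mul]; ring)
    simp only [bil, Pi.sub_apply, Pi.smul_apply, smul_eq_mul] at this ⊢
    linear_combination this
  have sym : ∀ x y : Fin 3 → K, bil c x y = bil c y x := by
    intro x y; simp only [bil]; ring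
  have s5 : ∀ x y : Fin 3 → K, eval v (lin n) ^ 2 * bil c x y
      = eval v (lin x) * eval v (lin y) * bil c n n := by
    intro x y
    have h1 := s4 x y
    have h2 := s4 y n
    rw [sym y n] at h2
    linear_combination eval v (lin n) * h1 + eval v (lin x) * h2
  obtain ⟨k, hk⟩ : ∃ k, k = bil c n n / (2 * eval v (lin n) ^ 2) := ⟨_, rfl⟩
  have hk2 : 2 * eval v (lin n) ^ 2 * k = bil c n n := by rw [hk]; field_simp
  have s6 : ∀ x y : Fin 3 → K, bil c x y = 2 * k * (eval v (lin x) * eval v (lin y)) := by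
    intro x y
    have h1 := s5 x y
    rw [← hk2] at h1
    have h2 : eval v (lin n) ^ 2 ≠ 0 := pow_ne_zero _ hn
    apply mul_left_cancel₀ h2
    rw [h1]; ring
  have two : (2 : K) ≠ 0 := two_ne_zero
  have hc : c = k • dirc v v := by
    have b := fun i j => s6 (Pi.single i 1) (Pi.single j 1)
    simp only [eval_lin] at b
    have b00 := b 0 0
    have b01 := b 0 1
    have b02 := b 0 2
    have b11 := b 1 1
    have b12 := b 1 2
    have b22 := b 2 2
    simp [bil] at b00 b01 b02 b11 b12 b22
    ext i
    fin_cases i <;> simp [dirc]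
    · apply mul_left_cancel₀ two; rw [b00]; ring
    · rw [b01]; ring
    · rw [b02]; ring
    · apply mul_left_cancel₀ two; rw [b11]; ring
    · rw [b12]; ring
    · apply mul_left_cancel₀ two; rw [b22]; ring
  have h1 := h (lin n ^ (e + 3)) (by
      have := ((lin_hom n).pow (e + 3))
      convert this using 1; ring)
  have hh : (G * lin n ^ (e + 3)).IsHomogeneous ((s + e + 2) + 1) := by
    have := hG.mul ((lin_hom n).pow (e + 3))
    convert this using 1; ring
  rw [hc, map_smul, LinearMap.smul_apply, euler2 hh] at h1
  have hk0 : k = 0 := by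
    by_contra hk0
    rw [smul_eq_mul] at h1
    refine mul_ne_zero hk0 (mul_ne_zero ?_ (mul_ne_zero ?_ ?_)) h1
    · exact_mod_cast (by omega : s + e + 2 ≠ 0)
    · exact_mod_cast (by omega : s + e + 2 + 1 ≠ 0)
    · rw [map_mul, map_pow]; exact mul_ne_zero hGv (pow_ne_zero _ hn)
  rw [hc, hk0, zero_smul]

/-- Pairwise projectively distinct vectors. -/
def PDist {ι : Type*} (v : ι → Fin 3 → K) : Prop :=
  ∀ i j, i ≠ j → ∃ a : Fin 3 → K, eval (v j) (lin a) = 0 ∧ eval (v i) (lin a) ≠ 0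

lemma LL_cube {a v : Fin 3 → K} (h : eval v (lin a) = 0) (c : Fin 6 → K) (A : MvPolynomial (Fin 3) K) :
    LL v c (lin a ^ 3 * A) = 0 := by
  have e : lin a ^ 3 * A = (lin a * lin a) * (lin a * A) := by ring
  rw [e, LL_mul_sing (sg_mul h h)]
  simp [h]

lemma indep_all {ι : Type*} [Fintype ι] {v : ι → Fin 3 → K} (hv : ∀ i, v i ≠ 0) (hd : PDist v)
    (e : ℕ) (c : ι → Fin 6 → K)
    (h : ∀ F : MvPolynomial (Fin 3) K, F.IsHomogeneous (3 * Fintype.card ι + e) →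
      ∑ i, LL (v i) (c i) F = 0) : c = 0 := by
  classical
  ext1 i
  choose a ha using fun j : {j // j ≠ i} => hd i j.1 (Ne.symm j.2)
  let G : MvPolynomial (Fin 3) K := ∏ j : {j // j ≠ i}, lin (a j) ^ 3
  have hcard : Fintype.card {j // j ≠ i} + 1 = Fintype.card ι := by
    have := Fintype.card_subtype_compl (fun j => j = i)
    simp only [Fintype.card_subtype_eq] at this
    have h1 : 0 < Fintype.card ι := Fintype.card_pos_iff.2 ⟨i⟩
    simp only [ne_eq]
    omega
  have hG : G.IsHomogeneous (3 * Fintype.card {j // j ≠ i}) := by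
    have := IsHomogeneous.prod (Finset.univ : Finset {j // j ≠ i}) (fun j => lin (a j) ^ 3)
      (fun _ => 3) (fun j _ => by simpa using (lin_hom (a j)).pow 3)
    simp only [Finset.sum_const, Finset.card_univ, smul_eq_mul] at this
    rw [mul_comm]; exact this
  refine indep_one (hv i) hG (e := e) ?_ (c i) ?_
  · simp only [G, map_prod, map_pow]
    exact Finset.prod_ne_zero_iff.2 fun j _ => pow_ne_zero _ (ha j).2
  · intro A hA
    have h1 := h (G * A) (by
      have := hG.mul hA
      convert this using 1; omega)
    rw [Finset.sum_eq_single i] at h1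
    · exact h1
    · intro j _ hj
      have : G = lin (a ⟨j, hj⟩) ^ 3 * ∏ k ∈ Finset.univ.erase ⟨j, hj⟩, lin (a k) ^ 3 := by
        rw [Finset.mul_prod_erase _ (fun k => lin (a k) ^ 3) (Finset.mem_univ _)]
      rw [this, mul_assoc]
      exact LL_cube (ha ⟨j, hj⟩).1 _ _
    · simp

end Bez
end

noncomputable section
set_option linter.unusedSectionVars false
set_option linter.unusedSimpArgs false
section Bez
variable {K : Type*} [Field K] [CharZero K]

/-- `(a,b) ↦ f a + q b` on forms -/
def koszul {m n k : ℕ} {f q : MvPolynomial (Fin 3) K} (hf : f.IsHomogeneous m) (hq : q.IsHomogeneous n) :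
    (homogeneousSubmodule (Fin 3) K (n + k) × homogeneousSubmodule (Fin 3) K (m + k)) →ₗ[K]
      homogeneousSubmodule (Fin 3) K (m + n + k) where
  toFun x := ⟨f * x.1.1 + q * x.2.1, by
    rw [mem_homogeneousSubmodule]
    refine IsHomogeneous.add ?_ ?_
    · have := hf.mul x.1.2
      convert this using 1; omega
    · have := hq.mul x.2.2
      convert this using 1; omega⟩
  map_add' x y := by ext1; simp; ring
  map_smul' c x := by ext1; simp [smul_eq_C_mul]; ring

lemma koszul_ker {m n k : ℕ} {f q : MvPolynomial (Fin 3) K} (hf : f.IsHomogeneous m)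
    (hq : q.IsHomogeneous n) (hf0 : f ≠ 0) (hq0 : q ≠ 0) (h : IsRelPrime f q) :
    Module.finrank K (LinearMap.ker (koszul (k := k) hf hq)) ≤ (k + 2).choose 2 := by
  let α : LinearMap.ker (koszul (k := k) hf hq) →ₗ[K] MvPolynomial (Fin 3) K :=
    (Submodule.subtype _).comp ((LinearMap.fst K _ _).comp (Submodule.subtype _))
  let β : homogeneousSubmodule (Fin 3) K k →ₗ[K] MvPolynomial (Fin 3) K :=
    (LinearMap.mulLeft K q).comp (Submodule.subtype _)
  have key : ∀ x : LinearMap.ker (koszul (k := k) hf hq), f * x.1.1.1 + q * x.1.2.1 = 0 := by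
    intro x
    have := congrArg Subtype.val (LinearMap.mem_ker.1 x.2)
    simpa [koszul] using this
  have hα : Function.Injective α := by
    intro x y hxy
    have h1 : x.1.1.1 = y.1.1.1 := hxy
    have h2 := key x
    have h4 := key y
    rw [h1] at h2
    have h3 : x.1.2.1 = y.1.2.1 := mul_left_cancel₀ hq0 (by linear_combination h2 - h4)
    ext1; ext1
    · ext1; exact h1
    · ext1; exact h3
  have hr : LinearMap.range α ≤ LinearMap.range β := by
    rintro _ ⟨x, rfl⟩
    have h1 : q ∣ f * x.1.1.1 := ⟨-x.1.2.1, by linear_combination key x⟩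
    have h2 : q ∣ x.1.1.1 := h.symm.dvd_of_dvd_mul_left h1
    obtain ⟨c, hc⟩ := h2
    by_cases hc0 : c = 0
    · refine ⟨0, ?_⟩
      change _ = x.1.1.1
      rw [hc, hc0]; simp
    · have h3 := x.1.1.2
      rw [mem_homogeneousSubmodule, hc] at h3
      obtain ⟨a, b, hab, ha, hb⟩ := hom_of_mul_left h3 (mul_ne_zero hq0 hc0)
      have : a = n := ha.inj_right hq hq0
      have hb' : b = k := by omega
      subst hb'
      exact ⟨⟨c, hb⟩, hc.symm⟩
  calc Module.finrank K (LinearMap.ker (koszul (k := k) hf hq))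
      = Module.finrank K (LinearMap.range α) := (LinearMap.finrank_range_of_inj hα).symm
    _ ≤ Module.finrank K (LinearMap.range β) := Submodule.finrank_mono hr
    _ ≤ Module.finrank K (homogeneousSubmodule (Fin 3) K k) := LinearMap.finrank_range_le β
    _ = _ := finrank_hom k

theorem bezout_core {ι : Type*} [Fintype ι] {v : ι → Fin 3 → K} (hv : ∀ i, v i ≠ 0) (hd : PDist v)
    {m n k e : ℕ} (hke : 3 * Fintype.card ι + e = m + n + k)
    {f q : MvPolynomial (Fin 3) K} (hf : f.IsHomogeneous m)
    (hq : q.IsHomogeneous n) (hf0 : f ≠ 0) (hq0 : q ≠ 0) (h : IsRelPrime f q)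
    (W : ι → Submodule K (Fin 6 → K))
    (hWf : ∀ i, ∀ c ∈ W i, ∀ A : MvPolynomial (Fin 3) K, A.IsHomogeneous (n + k) → LL (v i) c (f * A) = 0)
    (hWq : ∀ i, ∀ c ∈ W i, ∀ A : MvPolynomial (Fin 3) K, A.IsHomogeneous (m + k) → LL (v i) c (q * A) = 0) :
    ∑ i, Module.finrank K (W i) ≤ m * n := by
  let U := LinearMap.range (koszul (k := k) hf hq)
  let Ψ : (∀ i, W i) →ₗ[K] Module.Dual K (homogeneousSubmodule (Fin 3) K (m + n + k)) :=
    ∑ i, (LinearMap.lcomp K K (Submodule.subtype _)).comp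
      ((LL (v i)).comp ((Submodule.subtype _).comp (LinearMap.proj i)))
  have hΨ : ∀ (c : ∀ i, W i) x, Ψ c x = ∑ i, LL (v i) (c i).1 x.1 := by
    intro c x
    simp [Ψ, LinearMap.sum_apply]
  have inj : Function.Injective Ψ := by
    rw [← LinearMap.ker_eq_bot, LinearMap.ker_eq_bot']
    intro c hc
    have := indep_all hv hd e (fun i => (c i).1) (by
      intro F hF
      rw [hke] at hF
      rw [← hΨ c ⟨F, hF⟩, hc]; rfl)
    ext1 i
    ext1
    exact congrFun this i
  have hr : LinearMap.range Ψ ≤ U.dualAnnihilator := by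
    rintro _ ⟨c, rfl⟩
    rw [Submodule.mem_dualAnnihilator]
    rintro _ ⟨x, rfl⟩
    rw [hΨ]
    refine Finset.sum_eq_zero fun i _ => ?_
    change LL (v i) (c i).1 (f * x.1.1 + q * x.2.1) = 0
    rw [map_add, hWf i _ (c i).2 _ x.1.2, hWq i _ (c i).2 _ x.2.2, add_zero]
  have h1 : ∑ i, Module.finrank K (W i) ≤ Module.finrank K U.dualAnnihilator := by
    calc ∑ i, Module.finrank K (W i) = Module.finrank K (∀ i, W i) := (Module.finrank_pi_fintype K).symm
      _ = Module.finrank K (LinearMap.range Ψ) := (LinearMap.finrank_range_of_inj inj).symm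
      _ ≤ _ := Submodule.finrank_mono hr
  have h2 := Subspace.finrank_add_finrank_dualAnnihilator_eq U
  have h3 := LinearMap.finrank_range_add_finrank_ker (koszul (k := k) hf hq)
  have h4 := koszul_ker (k := k) hf hq hf0 hq0 h
  rw [Module.finrank_prod, finrank_hom, finrank_hom] at h3
  rw [finrank_hom] at h2
  have T : ∀ x : ℕ, 2 * (x + 2).choose 2 = (x + 2) * (x + 1) := by
    intro x
    rw [Nat.choose_two_right]
    have := Nat.even_mul_succ_self (x + 1)
    rw [mul_comm]
    rw [Nat.div_mul_cancel]
    · rfl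
    · rw [mul_comm]; exact this.two_dvd
  have t1 := T (m + n + k)
  have t2 := T (n + k)
  have t3 := T (m + k)
  have t4 := T k
  change Module.finrank K U + _ = _ at h3
  zify at *
  nlinarith
  
lemma ker_ge {N M : ℕ} (φ : (Fin N → K) →ₗ[K] (Fin M → K)) : N - M ≤ Module.finrank K (LinearMap.ker φ) := by
  have h1 := LinearMap.finrank_range_add_finrank_ker φ
  have h2 : Module.finrank K (LinearMap.range φ) ≤ M := by
    simpa using Submodule.finrank_le (LinearMap.range φ)
  simp at h1
  omega

/-- Bezout with three kinds of points. -/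
theorem bezout {ι : Type*} [Fintype ι] {v : ι → Fin 3 → K} (hv : ∀ i, v i ≠ 0) (hd : PDist v)
    {m n : ℕ} {f q : MvPolynomial (Fin 3) K} (hf : f.IsHomogeneous m)
    (hq : q.IsHomogeneous n) (hf0 : f ≠ 0) (hq0 : q ≠ 0) (h : IsRelPrime f q) (μ : ι → ℕ)
    (hμ : ∀ i, (μ i = 4 ∧ Sg f (v i) ∧ Sg q (v i)) ∨ (μ i = 2 ∧ Sg f (v i) ∧ eval (v i) q = 0) ∨
      (μ i = 1 ∧ eval (v i) f = 0 ∧ eval (v i) q = 0)) :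
    ∑ i, μ i ≤ m * n := by
  have hW : ∀ i, ∃ W : Submodule K (Fin 6 → K), μ i ≤ Module.finrank K W ∧
     (∀ c ∈ W, ∀ A : MvPolynomial (Fin 3) K, A.IsHomogeneous (n + (3 * Fintype.card ι + 1)) →
        LL (v i) c (f * A) = 0) ∧
     (∀ c ∈ W, ∀ A : MvPolynomial (Fin 3) K, A.IsHomogeneous (m + (3 * Fintype.card ι + 1)) →
        LL (v i) c (q * A) = 0) := by
    intro i
    rcases hμ i with ⟨h1, hF, hQ⟩ | ⟨h1, hF, hQ⟩ | ⟨h1, hF, hQ⟩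
    · let φ : (Fin 6 → K) →ₗ[K] (Fin 2 → K) :=
        LinearMap.pi ![(LL (v i)).flip f, (LL (v i)).flip q]
      refine ⟨LinearMap.ker φ, ?_, ?_, ?_⟩
      · rw [h1]; exact ker_ge φ
      · intro c hc A _
        have : LL (v i) c f = 0 := by simpa [φ] using congrFun (LinearMap.mem_ker.1 hc) 0
        rw [LL_mul_sing hF, this, mul_zero]
      · intro c hc A _
        have : LL (v i) c q = 0 := by simpa [φ] using congrFun (LinearMap.mem_ker.1 hc) 1
        rw [LL_mul_sing hQ, this, mul_zero]
    · let φ : (Fin 3 → K) →ₗ[K] (Fin 1 → K) :=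
        LinearMap.pi ![∑ j : Fin 3, eval (v i) (pderiv j q) • LinearMap.proj j]
      refine ⟨(LinearMap.ker φ).map (dirc (v i)), ?_, ?_, ?_⟩
      · rw [h1, ← LinearEquiv.finrank_eq (Submodule.equivMapOfInjective _ (dirc_inj (hv i)) _)]
        exact ker_ge φ
      · rintro _ ⟨w, hw, rfl⟩ A hA
        have hh : (f * A).IsHomogeneous (m + n + 3 * Fintype.card ι + 1) := by
          have := hf.mul hA
          convert this using 1; ring
        rw [LL_dirc hh]
        simp only [pderiv_mul, map_add, map_mul, hF.1, hF.2]
        ring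
      · rintro _ ⟨w, hw, rfl⟩ A hA
        have hh : (q * A).IsHomogeneous (m + n + 3 * Fintype.card ι + 1) := by
          have := hq.mul hA
          convert this using 1; ring
        rw [LL_dirc hh]
        have h2 := congrFun (LinearMap.mem_ker.1 hw) 0
        simp [φ, Fin.sum_univ_three] at h2
        simp only [pderiv_mul, map_add, map_mul, hQ]
        linear_combination ((m + n + 3 * Fintype.card ι : ℕ) : K) * eval (v i) A * h2
    · refine ⟨Submodule.span K {dirc (v i) (v i)}, ?_, ?_, ?_⟩
      · rw [h1, finrank_span_singleton]
        intro h0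
        exact hv i (dirc_inj (hv i) (by rw [h0, map_zero]))
      · intro c hc A hA
        obtain ⟨t, rfl⟩ := Submodule.mem_span_singleton.1 hc
        have hh : (f * A).IsHomogeneous (m + n + 3 * Fintype.card ι + 1) := by
          have := hf.mul hA
          convert this using 1; ring
        rw [map_smul, LinearMap.smul_apply, euler2 hh]
        simp [hF]
      · intro c hc A hA
        obtain ⟨t, rfl⟩ := Submodule.mem_span_singleton.1 hc
        have hh : (q * A).IsHomogeneous (m + n + 3 * Fintype.card ι + 1) := by
          have := hq.mul hA
          convert this using 1; ring
        rw [map_smul, LinearMap.smul_apply, euler2 hh]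
        simp [hQ]
  choose W h1 h2 h3 using hW
  calc ∑ i, μ i ≤ ∑ i, Module.finrank K (W i) := Finset.sum_le_sum fun i _ => h1 i
    _ ≤ m * n := bezout_core hv hd (e := m + n + 1) (k := 3 * Fintype.card ι + 1) (by ring)
        hf hq hf0 hq0 h W h2 h3

end Bez
end

noncomputable section
/-! ### Real polynomials -/
section RealPart

lemma hasDerivAt_eval (g : MvPolynomial (Fin 3) ℝ) (v w : Fin 3 → ℝ) (t : ℝ) :
    HasDerivAt (fun t : ℝ => eval (v + t • w) g)
      (∑ i, w i * eval (v + t • w) (pderiv i g)) t := by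
  induction g using MvPolynomial.induction_on with
  | C a => simpa using hasDerivAt_const t a
  | add p q hp hq =>
    have := hp.add hq
    simp only [map_add, mul_add, Finset.sum_add_distrib]
    exact this
  | mul_X p i hp =>
    have h1 : HasDerivAt (fun t : ℝ => v i + t * w i) (w i) t := by
      simpa using ((hasDerivAt_id t).mul_const (w i)).const_add (v i)
    have h2 := hp.mul h1
    simp only [map_mul, eval_X, Pi.add_apply, Pi.smul_apply, smul_eq_mul]
    refine h2.congr_deriv ?_
    rw [Finset.sum_mul]
    fin_cases i <;> simp [Fin.sum_univ_three, pderiv_X, Pi.single_apply] <;> ring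

lemma psd_sing {g : MvPolynomial (Fin 3) ℝ} (hg : Psd g) {v : Fin 3 → ℝ} (h : eval v g = 0) : Sg g v := by
  refine ⟨h, fun i => ?_⟩
  have h1 := hasDerivAt_eval g v (Pi.single i 1) 0
  have h2 : IsLocalMin (fun t : ℝ => eval (v + t • (Pi.single i 1 : Fin 3 → ℝ)) g) 0 := by
    refine Filter.Eventually.of_forall fun t => ?_
    simp only [zero_smul, add_zero, h]
    exact hg _
  have h3 := h2.hasDerivAt_eq_zero h1
  simpa [Pi.single_apply] using h3

lemma cont_line (p : MvPolynomial (Fin 3) ℝ) (v w : Fin 3 → ℝ) :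
    Continuous (fun t : ℝ => eval (v + t • w) p) :=
  continuous_iff_continuousAt.2 fun t => (hasDerivAt_eval p v w t).continuousAt

lemma neg_nhds {p : MvPolynomial (Fin 3) ℝ} {w : Fin 3 → ℝ} (hw : eval w p < 0) (f : Fin 3 → ℝ) :
    ∃ δ > 0, ∀ t : ℝ, |t| < δ → eval (w + t • f) p < 0 := by
  have h := (cont_line p w f).continuousAt (x := 0)
  have h2 : ∀ᶠ t in nhds (0 : ℝ), eval (w + t • f) p < 0 := by
    apply h.eventually_lt continuousAt_const
    simpa using hw
  obtain ⟨δ, h1, h3⟩ := Metric.eventually_nhds_iff.1 h2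
  exact ⟨δ, h1, fun t ht => h3 (by simpa [Real.dist_eq] using ht)⟩

/-- Determinant. -/
def det3 (u w e : Fin 3 → ℝ) : ℝ := (u 1 * w 2 - u 2 * w 1) * e 0 + (u 2 * w 0 - u 0 * w 2) * e 1
  + (u 0 * w 1 - u 1 * w 0) * e 2

/-- Cross product vector. -/
def crs (u w : Fin 3 → ℝ) : Fin 3 → ℝ := ![u 1 * w 2 - u 2 * w 1, u 2 * w 0 - u 0 * w 2, u 0 * w 1 - u 1 * w 0]

lemma eval_crs (u w e : Fin 3 → ℝ) : eval e (lin (crs u w)) = det3 u w e := by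
  rw [eval_lin]; simp [crs, det3]

lemma exists_det {u : Fin 3 → ℝ} (hu : u ≠ 0) : ∃ f e : Fin 3 → ℝ, det3 u f e ≠ 0 := by
  obtain ⟨i, hi⟩ := Function.ne_iff.1 hu
  fin_cases i
  · exact ⟨![0,1,0], ![0,0,1], by simpa [det3] using hi⟩
  · exact ⟨![1,0,0], ![0,0,1], by simpa [det3] using hi⟩
  · exact ⟨![1,0,0], ![0,1,0], by simpa [det3] using hi⟩

lemma common_zeros {p q : MvPolynomial (Fin 3) ℝ} (h : Psd (p * q)) {u w : Fin 3 → ℝ} (hu0 : u ≠ 0)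
    (hu : 0 < eval u p) (hw : eval w p < 0) (k : ℕ) :
    ∃ z : Fin k → Fin 3 → ℝ, (∀ i, z i ≠ 0) ∧ PDist z ∧ ∀ i, eval (z i) p = 0 ∧ eval (z i) q = 0 := by
  obtain ⟨f, e, hfe⟩ := exists_det hu0
  obtain ⟨w', hw', hD⟩ : ∃ w', eval w' p < 0 ∧ det3 u w' e ≠ 0 := by
    by_cases h0 : det3 u w e = 0
    · obtain ⟨δ, hδ, h1⟩ := neg_nhds hw f
      refine ⟨w + (δ / 2) • f, h1 _ (by rw [abs_of_pos (by linarith)]; linarith), ?_⟩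
      have : det3 u (w + (δ / 2) • f) e = det3 u w e + (δ / 2) * det3 u f e := by
        simp [det3]; ring
      rw [this, h0, zero_add]
      exact mul_ne_zero (by linarith) hfe
    · exact ⟨w, hw, h0⟩
  obtain ⟨δ, hδ, h1⟩ := neg_nhds hw' e
  let s : Fin k → ℝ := fun j => δ / ((j : ℕ) + 2)
  have hs : ∀ j, eval (w' + s j • e) p < 0 := by
    intro j
    apply h1
    have hj : (0 : ℝ) ≤ ((j : ℕ) : ℝ) := Nat.cast_nonneg _
    have : 0 < s j := by positivity
    rw [abs_of_pos this]
    apply div_lt_self hδ; linarith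
  have sinj : Function.Injective s := by
    intro a b hab
    simp only [s] at hab
    have ha : (0 : ℝ) ≤ ((a : ℕ) : ℝ) := Nat.cast_nonneg _
    have hb : (0 : ℝ) ≤ ((b : ℕ) : ℝ) := Nat.cast_nonneg _
    rw [div_eq_div_iff (by positivity) (by positivity)] at hab
    have := mul_left_cancel₀ hδ.ne' hab
    have h2 : ((a : ℕ) : ℝ) = ((b : ℕ) : ℝ) := by linarith
    exact Fin.ext (by exact_mod_cast h2)
  have key : ∀ j, ∃ t : ℝ, eval (u + t • ((w' + s j • e) - u)) p = 0 ∧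
      eval (u + t • ((w' + s j • e) - u)) q = 0 := by
    intro j
    have hc : Continuous (fun t : ℝ => eval (u + t • ((w' + s j • e) - u)) (p + q)) := cont_line _ _ _
    have q0 : 0 ≤ eval u q := by
      have := h u
      rw [map_mul] at this
      exact nonneg_of_mul_nonneg_right this hu
    have q1 : eval (w' + s j • e) q ≤ 0 := by
      have := h (w' + s j • e)
      rw [map_mul] at this
      by_contra hcon
      push Not at hcon
      nlinarith [hs j, mul_pos hcon (neg_pos.2 (hs j))]
    have hm : (0 : ℝ) ∈ Set.Icc (eval (u + (1 : ℝ) • ((w' + s j • e) - u)) (p + q))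
        (eval (u + (0 : ℝ) • ((w' + s j • e) - u)) (p + q)) := by
      simp only [one_smul, zero_smul, add_zero, add_sub_cancel, map_add]
      constructor
      · linarith [hs j]
      · linarith
    obtain ⟨t, -, ht⟩ := intermediate_value_Icc' (zero_le_one' ℝ) hc.continuousOn hm
    refine ⟨t, ?_⟩
    simp only [map_add] at ht
    have h2 := h (u + t • ((w' + s j • e) - u))
    rw [map_mul] at h2
    have h3 : eval (u + t • ((w' + s j • e) - u)) p = 0 := by nlinarith
    exact ⟨h3, by linarith⟩
  choose t ht using key
  have t0 : ∀ j, t j ≠ 0 := by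
    intro j h0
    have := (ht j).1
    rw [h0, zero_smul, add_zero] at this
    linarith
  refine ⟨fun j => u + t j • ((w' + s j • e) - u), ?_, ?_, ht⟩
  · intro j h0
    have : det3 u (u + t j • ((w' + s j • e) - u)) e = t j * det3 u w' e := by
      simp [det3]; ring
    simp only at h0
    rw [h0] at this
    apply mul_ne_zero (t0 j) hD
    rw [← this]; simp [det3]
  · intro i j hij
    refine ⟨crs u (w' + s j • e), ?_, ?_⟩
    · rw [eval_crs]; simp [det3]; ring
    · have : eval (u + t i • ((w' + s i • e) - u)) (lin (crs u (w' + s j • e)))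
          = t i * (s i - s j) * det3 u w' e := by
        rw [eval_crs]; simp [det3]; ring
      rw [this]
      exact mul_ne_zero (mul_ne_zero (t0 i) (sub_ne_zero.2 fun h => hij (sinj h))) hD

lemma eval_smul_hom {K : Type*} [Field K] {n : ℕ} {F : MvPolynomial (Fin 3) K} (hF : F.IsHomogeneous n)
    (t : K) (v : Fin 3 → K) : eval (t • v) F = t ^ n * eval v F := by
  have := congrArg (fun P => Polynomial.eval t (Polynomial.map (eval v) P)) (scaleHom_of_hom hF)
  simp only [Polynomial.map_mul, Polynomial.map_C, Polynomial.map_pow, Polynomial.map_X,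
    Polynomial.eval_mul, Polynomial.eval_C, Polynomial.eval_pow, Polynomial.eval_X] at this
  rw [mul_comm, ← this]
  have h2 : ((Polynomial.evalRingHom t).comp ((Polynomial.mapRingHom (eval v)).comp
      (scaleHom K).toRingHom)) = eval (t • v) := by
    apply MvPolynomial.ringHom_ext
    · intro r
      simp [scaleHom]
    · intro i
      simp [scaleHom]; ring
  rw [← h2]; rfl

/-- A polynomial negative somewhere is negative on a box, where a nonzero `p` cannot vanish. -/
lemma psd_div {p q : MvPolynomial (Fin 3) ℝ} (hp : Psd p) (hp0 : p ≠ 0) (h : Psd (p * q)) : Psd q := by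
  intro u
  by_contra hcon
  push Not at hcon
  have hc : Continuous (fun x : Fin 3 → ℝ => eval x q) := continuous_eval q
  obtain ⟨δ, hδ, h1⟩ := Metric.eventually_nhds_iff.1 (hc.continuousAt.eventually_lt continuousAt_const hcon)
  apply hp0
  refine MvPolynomial.funext_set (fun i => Set.Ioo (u i - δ / 2) (u i + δ / 2))
    (fun i => Set.Ioo_infinite (by linarith)) fun x hx => ?_
  have hx' : dist x u < δ := by
    rw [dist_pi_lt_iff hδ]
    intro i
    have := hx i (Set.mem_univ _)
    rw [Real.dist_eq, abs_lt]
    constructor <;> linarith [this.1, this.2]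
  have h2 := h1 hx'
  have h3 := h x
  rw [map_mul] at h3
  have h4 := hp x
  simp only [map_zero]
  nlinarith

/-- Alternative for irreducible factors of psd forms. -/
lemma factor_alt {N : ℕ} {p q : MvPolynomial (Fin 3) ℝ} (hh : (p * q).IsHomogeneous N) (h0 : p * q ≠ 0)
    (h : Psd (p * q)) (hp : Irreducible p) : p ∣ q ∨ Psd p ∨ Psd (-p) := by
  by_contra hcon
  push Not at hcon
  obtain ⟨h1, h2, h3⟩ := hcon
  simp only [Psd, not_forall, not_le] at h2 h3
  obtain ⟨w, hw⟩ := h2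
  obtain ⟨u, hu⟩ := h3
  rw [map_neg, neg_lt_zero] at hu
  obtain ⟨a, b, hab, ha, hb⟩ := hom_of_mul_left hh h0
  have hu0 : u ≠ 0 := by
    rintro rfl
    have e1 := eval_smul_hom ha 0 w
    have ha0 : a ≠ 0 := by
      rintro rfl
      have := (totalDegree_zero_iff_isHomogeneous _).2 ha
      rw [totalDegree_eq_zero_iff_eq_C] at this
      apply hp.not_isUnit
      rw [this]
      refine IsUnit.map C (isUnit_iff_ne_zero.2 fun h => ?_)
      rw [h, C_0] at this
      rw [this] at hw; simp at hw
    rw [zero_smul, zero_pow ha0, zero_mul] at e1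
    linarith
  obtain ⟨z, hz0, hzd, hz⟩ := common_zeros h hu0 hu hw (a * b + 1)
  have := bezout hz0 hzd ha hb (left_ne_zero_of_mul h0) (right_ne_zero_of_mul h0)
    ((hp.isRelPrime_iff_not_dvd).2 h1) (fun _ => 1) (fun i => Or.inr (Or.inr ⟨rfl, hz i⟩))
  simp at this

end RealPart
end

noncomputable section
section SosPart

lemma sos_of_isSumSq {g : MvPolynomial (Fin 3) ℝ} (h : IsSumSq g) : Sos g := by
  induction h with
  | zero => exact ⟨0, Fin.elim0, by simp⟩
  | sq_add a hs ih =>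
    obtain ⟨n, f, hf⟩ := ih
    refine ⟨n + 1, Fin.cons a f, ?_⟩
    rw [Fin.sum_univ_succ, hf]
    simp [sq]

lemma isSumSq_C {c : ℝ} (hc : 0 ≤ c) : IsSumSq (C c : MvPolynomial (Fin 3) ℝ) := by
  have : (C c : MvPolynomial (Fin 3) ℝ) = C (Real.sqrt c) * C (Real.sqrt c) := by
    rw [← C_mul, Real.mul_self_sqrt hc]
  rw [this]; exact IsSumSq.mul_self _

lemma isSumSq_sq (p : MvPolynomial (Fin 3) ℝ) : IsSumSq (p ^ 2) := by
  rw [sq]; exact IsSumSq.mul_self _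

lemma hom_zero {K : Type*} [Field K] {F : MvPolynomial (Fin 3) K} (h : F.IsHomogeneous 0) :
    F = C (coeff 0 F) :=
  totalDegree_eq_zero_iff_eq_C.1 ((totalDegree_zero_iff_isHomogeneous _).2 h)

/-- A nonnegative quadratic form is a sum of squares. -/
lemma quad_sum {m : MvPolynomial (Fin 3) ℝ} (hm : m.IsHomogeneous 2) (hp : Psd m) :
    ∃ (k : ℕ) (v : Fin k → Fin 3 → ℝ), m = ∑ i, (lin (v i)) ^ 2 := by
  let M : Matrix (Fin 3) (Fin 3) ℝ := fun i j => coeff 0 (pderiv i (pderiv j m)) / 2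
  have hM : ∀ i j (x : Fin 3 → ℝ), eval x (pderiv i (pderiv j m)) = 2 * M i j := by
    intro i j x
    have h0 : (pderiv i (pderiv j m)).IsHomogeneous 0 := (hm.pderiv (i := j)).pderiv (i := i)
    rw [hom_zero h0]; simp [M]; ring
  have hev : ∀ x : Fin 3 → ℝ, eval x m = ∑ i, ∑ j, x i * M i j * x j := by
    intro x
    have h1 := euler1 hm x
    have h2 : ∀ j, _ := fun j => euler1 (hm.pderiv (i := j)) x
    simp only [hM] at h2
    have a := h2 0
    have b := h2 1
    have c := h2 2
    simp only [Nat.add_one_sub_one, Nat.cast_one, one_mul, Nat.cast_ofNat] at a b c h1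
    simp only [Fin.sum_univ_three]
    rw [← a, ← b, ← c] at h1
    linarith
  have hps : M.PosSemidef := by
    refine Matrix.PosSemidef.of_dotProduct_mulVec_nonneg ?_ ?_
    · ext i j
      rw [Matrix.conjTranspose_apply]
      change star (coeff 0 (pderiv j (pderiv i m)) / 2) = coeff 0 (pderiv i (pderiv j m)) / 2
      rw [pderiv_comm3 i j]; rfl
    · intro x
      have := hp x
      rw [hev] at this
      simpa [dotProduct, Matrix.mulVec, Finset.mul_sum, mul_assoc] using this
  obtain ⟨k, v, hv⟩ := Matrix.posSemidef_iff_eq_sum_vecMulVec.1 hps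
  refine ⟨k, v, ?_⟩
  apply MvPolynomial.funext
  intro x
  rw [hev, map_sum, hv]
  simp only [Matrix.sum_apply, Matrix.vecMulVec_apply, map_pow, eval_lin]
  simp only [Fin.sum_univ_three, Finset.mul_sum, Finset.sum_mul, ← Finset.sum_add_distrib]
  refine Finset.sum_congr rfl fun i _ => ?_
  simp; ring

lemma quad_sumSq {m : MvPolynomial (Fin 3) ℝ} (hm : m.IsHomogeneous 2) (hp : Psd m) : IsSumSq m := by
  obtain ⟨k, v, rfl⟩ := quad_sum hm hp
  exact IsSumSq.sum fun i _ => isSumSq_sq _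

lemma odd_psd {F : MvPolynomial (Fin 3) ℝ} {n : ℕ} (hn : Odd n) (hF : F.IsHomogeneous n) (h : Psd F) :
    F = 0 := by
  apply MvPolynomial.funext
  intro x
  have h1 := h x
  have h2 := h (-x)
  have := eval_smul_hom hF (-1) x
  rw [hn.neg_one_pow, neg_one_smul] at this
  rw [map_zero]; linarith

lemma psd_mul {p q : MvPolynomial (Fin 3) ℝ} (hp : Psd p) (hq : Psd q) : Psd (p * q) := fun u => by
  rw [map_mul]; exact mul_nonneg (hp u) (hq u)

lemma psd_sq (p : MvPolynomial (Fin 3) ℝ) : Psd (p ^ 2) := fun u => by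
  rw [map_pow]; positivity

lemma nonunit_deg {K : Type*} [Field K] {p : MvPolynomial (Fin 3) K} {a : ℕ} (hp : p.IsHomogeneous a)
    (h0 : p ≠ 0) (h : ¬ IsUnit p) : a ≠ 0 := by
  rintro rfl
  rw [hom_zero hp] at h h0
  refine h (IsUnit.map C (isUnit_iff_ne_zero.2 fun e => ?_))
  rw [e, C_0] at h0; exact h0 rfl

lemma unit_of_deg {K : Type*} [Field K] {p : MvPolynomial (Fin 3) K} 
    (hp : p.IsHomogeneous 0) (h0 : p ≠ 0) : IsUnit p := by
  by_contra h
  exact nonunit_deg hp h0 h rfl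

/-- Structure of reducible psd forms. -/
lemma fact {f : MvPolynomial (Fin 3) ℝ} {N : ℕ} (hf : f.IsHomogeneous N) (hN : N ≠ 0) (hp : Psd f)
    (h0 : f ≠ 0) (hirr : ¬ Irreducible f) :
    (∃ p B a b, f = p ^ 2 * B ∧ p.IsHomogeneous a ∧ B.IsHomogeneous b ∧ Psd B ∧ 2 * a + b = N ∧ a ≠ 0) ∨
    (∃ p q a b, f = p * q ∧ p.IsHomogeneous a ∧ q.IsHomogeneous b ∧ Psd p ∧ Psd q ∧ a + b = N ∧
      a ≠ 0 ∧ b ≠ 0 ∧ Even a ∧ Even b) := by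
  have hnu : ¬ IsUnit f := by
    intro hu
    rw [MvPolynomial.isUnit_iff_eq_C_of_isReduced] at hu
    obtain ⟨c, hc, rfl⟩ := hu
    exact hN (hf.inj_right (isHomogeneous_C _ _) h0)
  obtain ⟨p, hpi, q, rfl⟩ := WfDvdMonoid.exists_irreducible_factor hnu h0
  have hq : ¬ IsUnit q := fun hq => hirr ((irreducible_mul_isUnit hq).2 hpi)
  obtain ⟨a, b, hab, ha, hb⟩ := hom_of_mul_left hf h0
  have hp0 := left_ne_zero_of_mul h0
  have hq0 := right_ne_zero_of_mul h0
  have ha0 := nonunit_deg ha hp0 hpi.not_isUnit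
  have hb0 := nonunit_deg hb hq0 hq
  have key : ∀ p q : MvPolynomial (Fin 3) ℝ, p.IsHomogeneous a → q.IsHomogeneous b → p * q ≠ 0 → Psd (p * q) → Psd p →
     (∃ p' q' a b, p * q = p' * q' ∧ p'.IsHomogeneous a ∧ q'.IsHomogeneous b ∧ Psd p' ∧ Psd q' ∧ a + b = N ∧
      a ≠ 0 ∧ b ≠ 0 ∧ Even a ∧ Even b) := by
    intro p q ha hb h0 hpq hP
    have hQ := psd_div hP (left_ne_zero_of_mul h0) hpq
    refine ⟨p, q, a, b, rfl, ha, hb, hP, hQ, hab, ha0, hb0, ?_, ?_⟩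
    · by_contra he
      exact left_ne_zero_of_mul h0 (odd_psd (Nat.not_even_iff_odd.1 he) ha hP)
    · by_contra he
      exact right_ne_zero_of_mul h0 (odd_psd (Nat.not_even_iff_odd.1 he) hb hQ)
  rcases factor_alt hf h0 hp hpi with ⟨B, rfl⟩ | h | h
  · left
    obtain ⟨a', b', hab', ha', hb'⟩ := hom_of_mul_left hb hq0
    have e : a = a' := ha.inj_right ha' hp0
    refine ⟨p, B, a, b', by ring, ha, hb', ?_, by omega, ha0⟩
    refine psd_div (psd_sq p) (pow_ne_zero _ hp0) ?_
    convert hp using 1; ring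
  · right
    exact key p q ha hb h0 hp h
  · right
    have := key (-p) (-q) ha.neg hb.neg (by simpa using h0) (by simpa using hp) h
    simpa using this

lemma psd_deg0 {B : MvPolynomial (Fin 3) ℝ} (hB : B.IsHomogeneous 0) (h : Psd B) : IsSumSq B := by
  have := h 0
  rw [hom_zero hB] at this ⊢
  exact isSumSq_C (by simpa using this)

lemma low_sumSq {B : MvPolynomial (Fin 3) ℝ} {b : ℕ} (hb2 : b ≤ 3) (hB : B.IsHomogeneous b) (h : Psd B) :
    IsSumSq B := by
  interval_cases b
  · exact psd_deg0 hB h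
  · rw [odd_psd (by decide) hB h]; exact IsSumSq.zero
  · exact quad_sumSq hB h
  · rw [odd_psd (by decide) hB h]; exact IsSumSq.zero

lemma fact4 {f : MvPolynomial (Fin 3) ℝ} (hf : f.IsHomogeneous 4) (hp : Psd f)
    (h0 : f ≠ 0) (hirr : ¬ Irreducible f) : IsSumSq f := by
  rcases fact hf (by norm_num) hp h0 hirr with ⟨p, B, a, b, rfl, ha, hb, hB, hab, ha0⟩ |
    ⟨p, q, a, b, rfl, ha, hb, hP, hQ, hab, ha0, hb0, ea, eb⟩
  · exact (isSumSq_sq p).mul (low_sumSq (by omega) hb hB)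
  · exact (low_sumSq (by omega) ha hP).mul (low_sumSq (by omega) hb hQ)

lemma fact6 {f : MvPolynomial (Fin 3) ℝ} (hf : f.IsHomogeneous 6) (hp : Psd f)
    (h0 : f ≠ 0) (hirr : ¬ Irreducible f) (hs : ¬ IsSumSq f) :
    ∃ m r, f = m * r ∧ m.IsHomogeneous 2 ∧ r.IsHomogeneous 4 ∧ Psd m ∧ Psd r := by
  rcases fact hf (by norm_num) hp h0 hirr with ⟨p, B, a, b, rfl, ha, hb, hB, hab, ha0⟩ |
    ⟨p, q, a, b, rfl, ha, hb, hP, hQ, hab, ha0, hb0, ea, eb⟩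
  · have : a = 1 ∨ b ≤ 3 := by omega
    rcases this with rfl | h
    · obtain rfl : b = 4 := by omega
      exact ⟨p ^ 2, B, rfl, ha.pow 2, hb, psd_sq p, hB⟩
    · exact absurd ((isSumSq_sq p).mul (low_sumSq h hb hB)) hs
  · obtain ⟨k, rfl⟩ := ea
    obtain ⟨l, rfl⟩ := eb
    have : k = 1 ∨ k = 2 := by omega
    rcases this with rfl | rfl
    · obtain rfl : l = 2 := by omega
      exact ⟨p, q, rfl, ha, hb, hP, hQ⟩
    · obtain rfl : l = 1 := by omega
      exact ⟨q, p, mul_comm _ _, hb, ha, hQ, hP⟩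

end SosPart
end

noncomputable section
section PointPart

lemma lin_sep {K : Type*} [Field K] {u w : Fin 3 → K} (hw : w ≠ 0) (h : ∀ t : K, u ≠ t • w) :
    ∃ a : Fin 3 → K, eval w (lin a) = 0 ∧ eval u (lin a) ≠ 0 := by
  by_contra! hc
  have h1 := hc ![w 1, - w 0, 0] (by rw [eval_lin]; simp; ring)
  have h2 := hc ![w 2, 0, - w 0] (by rw [eval_lin]; simp; ring)
  have h3 := hc ![0, w 2, - w 1] (by rw [eval_lin]; simp; ring)
  rw [eval_lin] at h1 h2 h3
  simp at h1 h2 h3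
  obtain ⟨k, hk⟩ : ∃ k, w k ≠ 0 := by
    by_contra! h; exact hw (funext h)
  apply h (u k / w k)
  ext i
  simp only [Pi.smul_apply, smul_eq_mul]
  field_simp
  fin_cases i <;> fin_cases k <;> simp at hk ⊢ <;> first | linear_combination h1 | linear_combination -h1 | linear_combination h2 | linear_combination -h2 | linear_combination h3 | linear_combination -h3

lemma rep_ne_smul {P Q : P2} (h : P ≠ Q) (t : ℝ) : P.rep ≠ t • Q.rep := by
  intro e
  apply h
  rw [← P.mk_rep, ← Q.mk_rep, Projectivization.mk_eq_mk_iff']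
  exact ⟨t, e.symm⟩

lemma rep_dist {ι : Type*} {P : ι → P2} (hP : Function.Injective P) : PDist (fun i => (P i).rep) := by
  intro i j hij
  exact lin_sep (P j).rep_nonzero (rep_ne_smul (hP.ne hij))

lemma exists_pts {S : Set P2} {k : ℕ} (h : (k : ℕ∞) ≤ S.encard) :
    ∃ P : Fin k → P2, Function.Injective P ∧ ∀ i, P i ∈ S := by
  obtain ⟨t, ht, hk⟩ := Set.exists_subset_encard_eq h
  have hf : t.Finite := Set.finite_of_encard_eq_coe hk
  have : Nat.card t = k := by
    rw [Nat.card_coe_set_eq, Set.ncard, hk]; rfl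
  have := hf.to_subtype
  let e := (Finite.equivFinOfCardEq ‹Nat.card t = k›).symm
  exact ⟨fun i => e i, Subtype.val_injective.comp e.injective, fun i => ht (e i).2⟩

lemma form_on {S : Set P2} {N : ℕ} (d : ℕ) (hN : N < (d + 2).choose 2) (h : S.encard ≤ N) :
    ∃ F : MvPolynomial (Fin 3) ℝ, F.IsHomogeneous d ∧ F ≠ 0 ∧ ∀ P ∈ S, VanishAt F P := by
  have hf : S.Finite := Set.finite_of_encard_le_coe h
  have := hf.to_subtype
  let e := Finite.equivFin S
  have hc : Nat.card S ≤ N := by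
    rw [Nat.card_coe_set_eq]
    rw [← hf.cast_ncard_eq] at h
    exact_mod_cast h
  obtain ⟨F, hF, h0, hv⟩ := exists_form (fun i => ((e.symm i : P2)).rep) (lt_of_le_of_lt hc hN)
  refine ⟨F, hF, h0, fun P hP => ?_⟩
  have := hv (e ⟨P, hP⟩)
  rw [Equiv.symm_apply_apply] at this
  exact this

lemma vanish_mk {F : MvPolynomial (Fin 3) ℝ} {n : ℕ} (hF : F.IsHomogeneous n) {v : Fin 3 → ℝ} (hv : v ≠ 0)
    (h : eval v F = 0) : VanishAt F (Projectivization.mk ℝ v hv) := by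
  obtain ⟨a, ha⟩ := Projectivization.exists_smul_eq_mk_rep ℝ v hv
  unfold VanishAt
  rw [← ha, Units.smul_def, eval_smul_hom hF, h, mul_zero]

lemma dvd_deg {K : Type*} [Field K] {p q : MvPolynomial (Fin 3) K} {a b : ℕ} (hp : p.IsHomogeneous a)
    (hq : q.IsHomogeneous b) (h0 : q ≠ 0) (h : p ∣ q) : a ≤ b := by
  obtain ⟨s, rfl⟩ := h
  obtain ⟨a', b', hab, ha, hb⟩ := hom_of_mul_left hq h0
  have := hp.inj_right ha (left_ne_zero_of_mul h0)
  omega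

lemma quart {r : MvPolynomial (Fin 3) ℝ} (hr : r.IsHomogeneous 4) (hp : Psd r)
    (h : (5 : ℕ) ≤ (VR r).encard) : IsSumSq r := by
  by_cases h0 : r = 0
  · rw [h0]; exact IsSumSq.zero
  by_cases hi : Irreducible r
  swap
  · exact fact4 hr hp h0 hi
  exfalso
  obtain ⟨P, hP, hm⟩ := exists_pts h
  obtain ⟨c, hc, hc0, hv⟩ := exists_form (d := 2) (fun i => (P i).rep) (by decide)
  have hrel : IsRelPrime r c := hi.isRelPrime_iff_not_dvd.2 fun hd => by
    have := dvd_deg hr hc hc0 hd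
    omega
  have := bezout (fun i => (P i).rep_nonzero) (rep_dist hP) hr hc h0 hc0 hrel (fun _ => 2)
    (fun i => Or.inr (Or.inl ⟨rfl, psd_sing hp (hm i), hv i⟩))
  simp at this

lemma VR_mul {p q : MvPolynomial (Fin 3) ℝ} : VR (p * q) = VR p ∪ VR q := by
  ext P; simp [VR, VanishAt]

lemma quad_inf {m : MvPolynomial (Fin 3) ℝ} (hm : m.IsHomogeneous 2) (hp : Psd m)
    (h : (2 : ℕ) ≤ (VR m).encard) : (VR m).Infinite := by
  obtain ⟨P, hP, hmem⟩ := exists_pts h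
  obtain ⟨k, v, hv⟩ := quad_sum hm hp
  have hz : ∀ x : Fin 3 → ℝ, eval x m = 0 ↔ ∀ i, eval x (lin (v i)) = 0 := by
    intro x
    rw [hv, map_sum]
    simp only [map_pow]
    rw [Finset.sum_eq_zero_iff_of_nonneg (fun i _ => by positivity)]
    simp
  set u := (P 0).rep with hu
  set w := (P 1).rep with hw
  have hne : ∀ t : ℝ, u ≠ t • w := rep_ne_smul (hP.ne (by decide))
  have hw0 : w ≠ 0 := (P 1).rep_nonzero
  have hne0 : ∀ s : ℝ, u + s • w ≠ 0 := by
    intro s hs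
    apply hne (-s)
    rw [neg_smul]; exact eq_neg_of_add_eq_zero_left hs
  have h1 : Function.Injective (fun s : ℝ => Projectivization.mk ℝ (u + s • w) (hne0 s)) := by
    intro s s' hs
    simp only [Projectivization.mk_eq_mk_iff'] at hs
    obtain ⟨t, ht⟩ := hs
    by_cases ht1 : t = 1
    · rw [ht1, one_smul] at ht
      exact (smul_left_injective ℝ hw0 (add_left_cancel ht)).symm
    · exfalso
      have h1t : (1 - t) ≠ 0 := sub_ne_zero.2 (Ne.symm ht1)
      apply hne ((t * s' - s) / (1 - t))
      ext i
      have := congrFun ht i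
      simp only [Pi.smul_apply, Pi.add_apply, smul_eq_mul] at this ⊢
      field_simp
      linarith
  refine Set.infinite_of_injective_forall_mem h1 fun s => ?_
  refine vanish_mk hm _ ((hz _).2 fun i => ?_)
  have e1 := (hz u).1 (hmem 0) i
  have e2 := (hz w).1 (hmem 1) i
  rw [eval_lin] at *
  simp only [Pi.smul_apply, Pi.add_apply, smul_eq_mul]
  linear_combination e1 + s * e2

lemma irr_ten {g : MvPolynomial (Fin 3) ℝ} (hg6 : g.IsHomogeneous 6) (hpsd : Psd g) (hnsos : ¬ IsSumSq g)
    (h : (VR g).encard = 10) : Irreducible g := by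
  have h0 : g ≠ 0 := by rintro rfl; exact hnsos IsSumSq.zero
  by_contra hi
  obtain ⟨m, r, rfl, hm, hr, pm, pr⟩ := fact6 hg6 hpsd h0 hi hnsos
  have h5 : (VR r).encard < 5 := by
    by_contra! h5
    exact hnsos ((quad_sumSq hm pm).mul (quart hr pr h5))
  have h2 : (VR m).encard < 2 := by
    by_contra! h2
    have := (quad_inf hm pm h2).mono (VR_mul (p := m) (q := r) ▸ Set.subset_union_left)
    rw [← Set.encard_eq_top_iff, h] at this
    exact absurd this (by decide)
  rw [VR_mul] at h
  have := Set.encard_union_le (VR m) (VR r)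
  rw [h] at this
  have h3 : (VR m).encard + (VR r).encard ≤ 2 + 5 := add_le_add h2.le h5.le
  have := this.trans h3
  norm_num at this

lemma pos_val {g : MvPolynomial (Fin 3) ℝ} (hp : Psd g) (h0 : g ≠ 0) : ∃ u, 0 < eval u g := by
  by_contra! h
  apply h0
  apply MvPolynomial.funext
  intro x
  rw [map_zero]; exact le_antisymm (h x) (hp x)

lemma irr_exp {g : MvPolynomial (Fin 3) ℝ} (hg6 : g.IsHomogeneous 6) (hpsd : Psd g) (hnsos : ¬ IsSumSq g)
    (h : ∀ g' : MvPolynomial (Fin 3) ℝ, g'.IsHomogeneous 6 → Psd g' →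
      VR g ⊆ VR g' → ∃ c : ℝ, 0 ≤ c ∧ g' = c • g) : Irreducible g := by
  have h0 : g ≠ 0 := by rintro rfl; exact hnsos IsSumSq.zero
  by_contra hi
  obtain ⟨m, r, rfl, hm, hr, pm, pr⟩ := fact6 hg6 hpsd h0 hi hnsos
  have h5 : (VR r).encard < (4 : ℕ) + 1 := by
    by_contra! h5
    exact hnsos ((quad_sumSq hm pm).mul (quart hr pr (by exact_mod_cast h5)))
  have h4 : (VR r).encard ≤ (4 : ℕ) := Order.le_of_lt_add_one h5
  obtain ⟨c, hc, hc0, hv⟩ := form_on 2 (by decide) h4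
  obtain ⟨l, hl, e⟩ := h (m * c ^ 2) (hm.mul (hc.pow 2)) (psd_mul pm (psd_sq c)) (by
    rw [VR_mul, VR_mul]
    refine Set.union_subset_union_right _ fun P hP => ?_
    have := hv P hP
    simp only [VR, Set.mem_ofPred_eq, VanishAt] at this ⊢
    rw [map_pow, this]; simp)
  have hm0 := left_ne_zero_of_mul h0
  rw [smul_eq_C_mul] at e
  have e' : c ^ 2 = C l * r := mul_left_cancel₀ hm0 (by rw [e]; ring)
  have hl0 : l ≠ 0 := by
    rintro rfl
    rw [C_0, zero_mul] at e'
    exact hc0 (pow_eq_zero_iff (by norm_num) |>.1 e')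
  have : r = C (l⁻¹) * c ^ 2 := by
    rw [e', ← mul_assoc, ← C_mul, inv_mul_cancel₀ hl0, C_1, one_mul]
  apply hnsos
  rw [this]
  exact (quad_sumSq hm pm).mul ((isSumSq_C (inv_nonneg.2 hl)).mul (isSumSq_sq c))

/-- The easy half of the theorem. -/
lemma exposed_of_ten {g : MvPolynomial (Fin 3) ℝ} (hg6 : g.IsHomogeneous 6) (hpsd : Psd g)
    (hnsos : ¬ IsSumSq g) (h : (VR g).encard = 10) :
    ∀ g' : MvPolynomial (Fin 3) ℝ, g'.IsHomogeneous 6 → Psd g' →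
      VR g ⊆ VR g' → ∃ c : ℝ, 0 ≤ c ∧ g' = c • g := by
  intro g' hg' hp' hsub
  have hi := irr_ten hg6 hpsd hnsos h
  by_cases h0 : g' = 0
  · exact ⟨0, le_rfl, by simp [h0]⟩
  by_cases hd : g ∣ g'
  · obtain ⟨k, rfl⟩ := hd
    obtain ⟨a, b, hab, ha, hb⟩ := hom_of_mul_left hg' h0
    obtain rfl : 6 = a := hg6.inj_right ha hi.ne_zero
    obtain rfl : b = 0 := by omega
    refine ⟨coeff 0 k, ?_, ?_⟩
    · have := psd_div hpsd hi.ne_zero hp' 0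
      rw [hom_zero hb] at this
      simpa using this
    · rw [smul_eq_C_mul, ← hom_zero hb, mul_comm]
  · exfalso
    obtain ⟨P, hP, hm⟩ := exists_pts (S := VR g) (k := 10) (by rw [h]; rfl)
    have := bezout (fun i => (P i).rep_nonzero) (rep_dist hP) hg6 hg' hi.ne_zero h0
      (hi.isRelPrime_iff_not_dvd.2 hd) (fun _ => 4)
      (fun i => Or.inl ⟨rfl, psd_sing hpsd (hm i), psd_sing hp' (hsub (hm i))⟩)
    simp at this

lemma exposed_ge {g : MvPolynomial (Fin 3) ℝ} (hnsos : ¬ IsSumSq g)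
    (h : ∀ g' : MvPolynomial (Fin 3) ℝ, g'.IsHomogeneous 6 → Psd g' →
      VR g ⊆ VR g' → ∃ c : ℝ, 0 ≤ c ∧ g' = c • g) : 10 ≤ (VR g).encard := by
  by_contra! hlt
  have h9 : (VR g).encard ≤ (9 : ℕ) := Order.le_of_lt_add_one (by
    refine hlt.trans_le ?_
    norm_num)
  obtain ⟨c, hc, hc0, hv⟩ := form_on 3 (by decide) h9
  obtain ⟨l, hl, e⟩ := h (c ^ 2) (hc.pow 2) (psd_sq c) (by
    intro P hP
    have := hv P hP
    simp only [VR, Set.mem_ofPred_eq, VanishAt] at this ⊢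
    rw [map_pow, this]; simp)
  rw [smul_eq_C_mul] at e
  have hl0 : l ≠ 0 := by
    rintro rfl
    rw [C_0, zero_mul] at e
    exact hc0 (pow_eq_zero_iff (by norm_num) |>.1 e)
  have : g = C (l⁻¹) * c ^ 2 := by
    rw [e, ← mul_assoc, ← C_mul, inv_mul_cancel₀ hl0, C_1, one_mul]
  apply hnsos
  rw [this]
  exact (isSumSq_C (inv_nonneg.2 hl)).mul (isSumSq_sq c)

end PointPart
end

noncomputable section
section ComplexPart

/-- Complexification of real polynomials. -/
abbrev mC : MvPolynomial (Fin 3) ℝ →+* MvPolynomial (Fin 3) ℂ := map Complex.ofRealHom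

/-- Complexification of real vectors. -/
def vC (v : Fin 3 → ℝ) : Fin 3 → ℂ := Complex.ofRealHom ∘ v

lemma vC_apply (v : Fin 3 → ℝ) (i : Fin 3) : vC v i = (v i : ℂ) := rfl

lemma eval_mC (v : Fin 3 → ℝ) (p : MvPolynomial (Fin 3) ℝ) : eval (vC v) (mC p) = (eval v p : ℂ) :=
  (map_eval Complex.ofRealHom v p).symm

lemma sg_mC {v : Fin 3 → ℝ} {p : MvPolynomial (Fin 3) ℝ} (h : Sg p v) : Sg (mC p) (vC v) := by
  refine ⟨by rw [eval_mC, h.1]; simp, fun i => ?_⟩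
  rw [pderiv_map, eval_mC, h.2 i]; simp

lemma vC_ne_zero {v : Fin 3 → ℝ} (h : v ≠ 0) : vC v ≠ 0 := by
  intro e
  apply h
  ext i
  have := congrFun e i
  simpa [vC_apply] using this

lemma vC_sep {u w : Fin 3 → ℝ} (h : ∀ t : ℝ, u ≠ t • w) (hw : w ≠ 0) (t : ℂ) : vC u ≠ t • vC w := by
  intro e
  obtain ⟨a, ha, hb⟩ := lin_sep hw h
  rw [eval_lin] at ha hb
  apply hb
  have e0 := congrFun e 0
  have e1 := congrFun e 1
  have e2 := congrFun e 2
  simp only [vC_apply, Pi.smul_apply, smul_eq_mul] at e0 e1 e2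
  have ha' := congrArg (fun x : ℝ => (x : ℂ)) ha
  push_cast at ha'
  have : ((a 0 * u 0 + a 1 * u 1 + a 2 * u 2 : ℝ) : ℂ) = 0 := by
    push_cast
    rw [e0, e1, e2]
    linear_combination t * ha'
  exact_mod_cast this

/-- Restriction to a parametrised line. -/
def lineP (G : MvPolynomial (Fin 3) ℂ) (a b : Fin 3 → ℂ) : Polynomial ℂ :=
  aeval (fun i => Polynomial.C (a i) + Polynomial.C (b i) * Polynomial.X) G

lemma eval_lineP (G : MvPolynomial (Fin 3) ℂ) (a b : Fin 3 → ℂ) (t : ℂ) :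
    (lineP G a b).eval t = eval (a + t • b) G := by
  have h : (Polynomial.evalRingHom t).comp
      (aeval (fun i => Polynomial.C (a i) + Polynomial.C (b i) * Polynomial.X) :
        MvPolynomial (Fin 3) ℂ →ₐ[ℂ] Polynomial ℂ).toRingHom = eval (a + t • b) := by
    apply MvPolynomial.ringHom_ext
    · intro r; simp
    · intro i; simp; ring
  rw [← h]; rfl

lemma exists_root_line {G : MvPolynomial (Fin 3) ℂ} (hG : G.IsHomogeneous 6) {u : Fin 3 → ℂ}
    (hu : eval u G ≠ 0) (e : Fin 3 → ℂ) : ∃ t : ℂ, eval (e + t • u) G = 0 := by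
  by_cases hd : (lineP G e u).degree = 0
  · exfalso
    have hc := Polynomial.eq_C_of_degree_eq_zero hd
    set c := (lineP G e u).coeff 0
    have h1 : ∀ t : ℂ, eval (e + t • u) G = c := by
      intro t; rw [← eval_lineP, hc, Polynomial.eval_C]
    have h2 : lineP G u e = Polynomial.C c * Polynomial.X ^ 6 := by
      apply Polynomial.eq_of_infinite_eval_eq
      refine Set.Infinite.mono (s := {0}ᶜ) ?_ (Set.finite_singleton (0 : ℂ)).infinite_compl
      intro x hx
      have hx : x ≠ 0 := hx
      change (lineP G u e).eval x = _
      rw [eval_lineP]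
      have : u + x • e = x • (e + x⁻¹ • u) := by
        rw [smul_add, smul_smul, mul_inv_cancel₀ hx, one_smul, add_comm]
      rw [this, eval_smul_hom hG, h1]
      rw [Polynomial.eval_mul, Polynomial.eval_C, Polynomial.eval_pow, Polynomial.eval_X, mul_comm]
    apply hu
    have := eval_lineP G u e 0
    rw [h2] at this
    simpa using this.symm
  · obtain ⟨t, ht⟩ := IsAlgClosed.exists_root _ hd
    exact ⟨t, by rw [← eval_lineP]; exact ht⟩

lemma complex_family {g : MvPolynomial (Fin 3) ℝ} (hg : g.IsHomogeneous 6) {u : Fin 3 → ℝ}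
    (hu : eval u g ≠ 0) : ∃ z : ℂ → Fin 3 → ℂ, (∀ s, z s ≠ 0) ∧ (∀ s, eval (z s) (mC g) = 0) ∧
      ∀ (s s1 t : ℂ), z s = t • z s1 → s = s1 := by
  have hu0 : u ≠ 0 := by
    rintro rfl
    have := eval_smul_hom hg 0 0
    rw [zero_smul, zero_pow (by norm_num), zero_mul] at this
    exact hu this
  obtain ⟨f, e, hd⟩ := exists_det hu0
  have hG : (mC g).IsHomogeneous 6 := hg.map _
  have hu' : eval (vC u) (mC g) ≠ 0 := by rw [eval_mC]; exact_mod_cast hu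
  choose t ht using fun s : ℂ => exists_root_line hG hu' (vC f + s • vC e)
  have hd' : (u 1 * f 2 - u 2 * f 1) * e 0 + (u 2 * f 0 - u 0 * f 2) * e 1
      + (u 0 * f 1 - u 1 * f 0) * e 2 ≠ (0 : ℂ) := by
    unfold det3 at hd; exact_mod_cast hd
  have ind : ∀ x y z : ℂ, (∀ i, x * u i + y * f i + z * e i = 0) → y = 0 ∧ z = 0 := by
    intro x y z h
    have h0 := h 0
    have h1 := h 1
    have h2 := h 2
    constructor
    · refine (mul_eq_zero.1 ?_).resolve_right hd'
      linear_combination (u 2 * e 1 - u 1 * e 2) * h0 + (u 0 * e 2 - u 2 * e 0) * h1 +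
        (u 1 * e 0 - u 0 * e 1) * h2
    · refine (mul_eq_zero.1 ?_).resolve_right hd'
      linear_combination (u 1 * f 2 - u 2 * f 1) * h0 + (u 2 * f 0 - u 0 * f 2) * h1 +
        (u 0 * f 1 - u 1 * f 0) * h2
  refine ⟨fun s => vC f + s • vC e + t s • vC u, ?_, ht, ?_⟩
  · intro s h
    have := (ind (t s) 1 s fun i => by
      have := congrFun h i
      simp only [vC_apply, Pi.smul_apply, Pi.add_apply, smul_eq_mul, Pi.zero_apply] at this
      linear_combination this).1
    exact one_ne_zero this
  · intro s s' l h
    have := ind (t s - l * t s') (1 - l) (s - l * s') fun i => by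
      have := congrFun h i
      simp only [vC_apply, Pi.smul_apply, Pi.add_apply, smul_eq_mul] at this
      linear_combination this
    have hl : l = 1 := by linear_combination -this.1
    rw [hl] at this
    linear_combination this.2

lemma re_im (p : MvPolynomial (Fin 3) ℂ) : ∃ a b, p = mC a + C Complex.I * mC b := by
  induction p using MvPolynomial.induction_on with
  | C c =>
    refine ⟨C c.re, C c.im, ?_⟩
    rw [map_C, map_C, ← C_mul, ← C_add]
    congr 1
    simp only [Complex.ofRealHom_eq_coe]
    rw [mul_comm]; exact (Complex.re_add_im c).symm
  | add p q hp hq =>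
    obtain ⟨a, b, rfl⟩ := hp
    obtain ⟨c, d, rfl⟩ := hq
    exact ⟨a + c, b + d, by simp only [map_add]; ring⟩
  | mul_X p i hp =>
    obtain ⟨a, b, rfl⟩ := hp
    exact ⟨a * X i, b * X i, by simp only [map_mul, map_X]; ring⟩

lemma re_im_unique {x y z : MvPolynomial (Fin 3) ℝ} (h : mC x + C Complex.I * mC y = mC z) : x = z := by
  ext m
  have := congrArg (fun p => (coeff m p).re) h
  simpa [coeff_map, coeff_C_mul] using this

lemma descend {h g : MvPolynomial (Fin 3) ℝ} (hd : mC h ∣ mC g) : h ∣ g := by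
  obtain ⟨k, hk⟩ := hd
  obtain ⟨a, b, rfl⟩ := re_im k
  refine ⟨a, (re_im_unique (y := h * b) ?_).symm⟩
  rw [hk, map_mul, map_mul]; ring

/-- Complex conjugation of coefficients. -/
def cj : MvPolynomial (Fin 3) ℂ ≃+* MvPolynomial (Fin 3) ℂ := mapEquiv (Fin 3) (starRingAut : ℂ ≃+* ℂ)

lemma cj_mC (a : MvPolynomial (Fin 3) ℝ) : cj (mC a) = mC a := by
  induction a using MvPolynomial.induction_on with
  | C c => simp [cj]
  | add p q hp hq => rw [map_add, map_add, hp, hq]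
  | mul_X p i hp => 
    rw [map_mul, map_mul, hp]
    simp [cj]

lemma cj_I : cj (C Complex.I) = - C Complex.I := by
  simp [cj]

lemma no_common {g : MvPolynomial (Fin 3) ℝ} {q : MvPolynomial (Fin 3) ℂ} (hg : g.IsHomogeneous 6)
    (hi : Irreducible g) (hp : Psd g) (hs : ¬ IsSumSq g) (hq : q.IsHomogeneous 4) (hq0 : q ≠ 0) :
    IsRelPrime (mC g) q := by
  by_contra hr
  obtain ⟨d, hdg, hdq, hdu⟩ : ∃ d, d ∣ mC g ∧ d ∣ q ∧ ¬ IsUnit d := by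
    simpa [IsRelPrime] using hr
  have hd0 : d ≠ 0 := fun h => hq0 (zero_dvd_iff.1 (h ▸ hdq))
  obtain ⟨p, pi, pd⟩ := WfDvdMonoid.exists_irreducible_factor hdu hd0
  have pg := pd.trans hdg
  have pq := pd.trans hdq
  -- real factor of `p` up to units gives a contradiction
  have key : ∀ e, p ∣ mC e → mC e ∣ p → False := by
    intro e h1 h2
    obtain ⟨k, hk⟩ := descend (h2.trans pg)
    have he : ¬ IsUnit e := fun h => pi.not_isUnit (isUnit_of_dvd_unit h1 (h.map mC))
    have hku := (hi.isUnit_or_isUnit hk).resolve_left he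
    have : g ∣ e := by
      rw [hk]; exact (hku.mul_right_dvd).2 dvd_rfl
    have := dvd_deg (hg.map Complex.ofRealHom) hq hq0 (((map_dvd mC this).trans h2).trans pq)
    omega
  obtain ⟨a, b, hab⟩ := re_im p
  have hc : cj p = mC a - C Complex.I * mC b := by
    rw [hab, map_add, map_mul, cj_mC, cj_mC, cj_I]; ring
  have cg : cj p ∣ mC g := by
    have := map_dvd cj pg
    rwa [cj_mC] at this
  have ci : Irreducible (cj p) := (MulEquiv.irreducible_iff cj).2 pi
  have hI : (C Complex.I * C Complex.I : MvPolynomial (Fin 3) ℂ) = -1 := by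
    rw [← C_mul, Complex.I_mul_I]; simp
  have hu2 : IsUnit (C 2 : MvPolynomial (Fin 3) ℂ) := IsUnit.map C (isUnit_iff_ne_zero.2 two_ne_zero)
  have h2 : (C 2 : MvPolynomial (Fin 3) ℂ) = 2 := map_ofNat C 2
  by_cases hdv : p ∣ cj p
  · have hdv' : cj p ∣ p := (pi.dvd_comm ci).1 hdv
    obtain ⟨w, hw⟩ := (pi.associated_of_dvd ci hdv)
    obtain ⟨ω, hω, e⟩ := MvPolynomial.isUnit_iff_eq_C_of_isReduced.1 w.isUnit
    rw [e] at hw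
    have pa : p ∣ mC a := by
      have : p ∣ C 2 * mC a := by
        have h := dvd_add (dvd_refl p) hdv
        rw [hc] at h
        nth_rewrite 2 [hab] at h
        convert h using 1
        rw [h2]; ring
      exact (hu2.dvd_mul_left).1 this
    by_cases h1 : ω = -1
    · have ha : mC a = 0 := by
        rw [h1, hc, hab] at hw
        have : C 2 * mC a = 0 := by
          rw [h2]
          simp only [C_neg, C_1] at hw
          linear_combination -hw
        exact (mul_eq_zero.1 this).resolve_left hu2.ne_zero
      have hIu : IsUnit (C Complex.I : MvPolynomial (Fin 3) ℂ) :=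
        IsUnit.map C (isUnit_iff_ne_zero.2 Complex.I_ne_zero)
      rw [ha, zero_add] at hab
      refine key b ?_ ⟨C Complex.I, by rw [hab, mul_comm]⟩
      rw [hab]
      exact (hIu.mul_left_dvd).2 dvd_rfl
    · refine key a pa ?_
      have hne : (1 + ω) ≠ 0 := fun h => h1 (by linear_combination h)
      have hcu : IsUnit (C (1 + ω) : MvPolynomial (Fin 3) ℂ) := IsUnit.map C (isUnit_iff_ne_zero.2 hne)
      refine (hcu.dvd_mul_left).1 ⟨C 2, ?_⟩
      rw [C_add, C_1, add_mul, mul_comm (C ω), hw, hc, hab, h2]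
      ring
  · have hrel : IsRelPrime p (cj p) := pi.isRelPrime_iff_not_dvd.2 hdv
    have hmul := hrel.mul_dvd pg cg
    have hN : p * cj p = mC (a ^ 2 + b ^ 2) := by
      rw [hc, hab]
      simp only [map_add, map_pow]
      linear_combination -(mC b) ^ 2 * hI
    rw [hN] at hmul
    obtain ⟨k, hk⟩ := descend hmul
    have hnu : ¬ IsUnit (a ^ 2 + b ^ 2) := fun h => by
      have := h.map mC
      rw [← hN] at this
      exact pi.not_isUnit (isUnit_of_mul_isUnit_left this)
    have hku := (hi.isUnit_or_isUnit hk).resolve_left hnu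
    obtain ⟨c, hc0, rfl⟩ := MvPolynomial.isUnit_iff_eq_C_of_isReduced.1 hku
    have hss : IsSumSq (a ^ 2 + b ^ 2) := (isSumSq_sq a).add (isSumSq_sq b)
    have hP : Psd (a ^ 2 + b ^ 2) := fun x => by
      simp only [map_add, map_pow]; positivity
    have hab0 : a ^ 2 + b ^ 2 ≠ 0 := fun h => hi.ne_zero (by rw [hk, h, zero_mul])
    have hck : Psd (C c) := psd_div hP hab0 (hk ▸ hp)
    apply hs
    rw [hk]
    exact hss.mul (psd_deg0 (isHomogeneous_C _ _) hck)

lemma le_ten {g : MvPolynomial (Fin 3) ℝ} (hg : g.IsHomogeneous 6)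
    (hi : Irreducible g) (hp : Psd g) (hs : ¬ IsSumSq g) : (VR g).encard < (11 : ℕ) := by
  by_contra! h
  obtain ⟨P, hP, hm⟩ := exists_pts h
  obtain ⟨u, hu⟩ := pos_val hp hi.ne_zero
  obtain ⟨z, hz0, hz, hzd⟩ := complex_family hg hu.ne'
  have hfin : (⋃ i : Fin 11, {s : ℂ | ∃ t : ℂ, z s = t • vC (P i).rep}).Finite := by
    refine Set.finite_iUnion fun i => Set.Subsingleton.finite ?_
    rintro s ⟨t, ht⟩ s' ⟨t', ht'⟩
    have ht0 : t' ≠ 0 := by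
      rintro rfl
      rw [zero_smul] at ht'
      exact hz0 _ ht'
    apply hzd s s' (t / t')
    rw [ht', ht, smul_smul, div_mul_cancel₀ _ ht0]
  let S := hfin.infinite_compl.natEmbedding
  have hS : ∀ (n : ℕ) (i : Fin 11) (t : ℂ), z (S n) ≠ t • vC (P i).rep := by
    intro n i t e
    exact (S n).2 (Set.mem_iUnion.2 ⟨i, t, e⟩)
  let v : Fin 11 ⊕ Fin 3 → Fin 3 → ℂ := Sum.elim (fun i => vC (P i).rep) (fun j => z (S j.1))
  have hv0 : ∀ i, v i ≠ 0 := by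
    rintro (i | j)
    · exact vC_ne_zero (P i).rep_nonzero
    · exact hz0 _
  have hvd : PDist v := by
    intro i j hij
    refine lin_sep (hv0 j) ?_
    rcases i with i | i <;> rcases j with j | j <;> intro t e <;> simp only [v, Sum.elim_inl, Sum.elim_inr] at e
    · exact vC_sep (rep_ne_smul (hP.ne (fun h => hij (by rw [h])))) (P j).rep_nonzero t e
    · have ht0 : t ≠ 0 := by
        rintro rfl
        rw [zero_smul] at e
        exact vC_ne_zero (P i).rep_nonzero e
      refine hS j i t⁻¹ ?_
      rw [e, smul_smul, inv_mul_cancel₀ ht0, one_smul]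
    · exact hS i j t e
    · have := S.injective (Subtype.ext (hzd _ _ _ e))
      exact hij (by rw [Fin.ext this])
  obtain ⟨q, hq, hq0, hqv⟩ := exists_form (d := 4) (fun i : Fin 14 => v (finSumFinEquiv.symm i)) (by decide)
  have hqv' : ∀ i, eval (v i) q = 0 := by
    intro i
    have := hqv (finSumFinEquiv i)
    rwa [Equiv.symm_apply_apply] at this
  have hrel := no_common hg hi hp hs hq hq0
  have hg0 : mC g ≠ 0 := fun h => hi.ne_zero
    (map_injective Complex.ofRealHom Complex.ofRealHom.injective (by rw [map_zero]; exact h))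
  have := bezout hv0 hvd (hg.map Complex.ofRealHom) hq hg0 hq0 hrel (Sum.elim (fun _ => 2) (fun _ => 1)) (by
    rintro (i | j)
    · exact Or.inr (Or.inl ⟨rfl, sg_mC (psd_sing hp (hm i)), hqv' _⟩)
    · exact Or.inr (Or.inr ⟨rfl, hz _, hqv' _⟩))
  simp at this

end ComplexPart
end

theorem statement19 (g : MvPolynomial (Fin 3) ℝ) (hg6 : g.IsHomogeneous 6)
    (hpsd : Psd g) (hnsos : ¬ Sos g) :
    (∀ g' : MvPolynomial (Fin 3) ℝ, g'.IsHomogeneous 6 → Psd g' →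
      VR g ⊆ VR g' → ∃ c : ℝ, 0 ≤ c ∧ g' = c • g) ↔ (VR g).encard = 10 := by
  have hs : ¬ IsSumSq g := fun h => hnsos (sos_of_isSumSq h)
  constructor
  · intro h
    have h1 := exposed_ge hs h
    have h2 := le_ten hg6 (irr_exp hg6 hpsd hs h) hpsd hs
    refine le_antisymm (Order.le_of_lt_add_one (h2.trans_le ?_)) h1
    norm_num
  · exact exposed_of_ten hg6 hpsd hs

end
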